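/- arXiv:2012.08964 — 5 statements merged into one kernel-verified Lean document; each statement's English description precedes it below -/
import Mathlib

section
/- Uniqueness of the lowest ellipsoid: Let C be a convex body in ℝ^d that contains an ellipsoid of volume one. Then there is a unique ellipsoid E ⊆ C of volume one such that every other ellipsoid of volume one contained in C has strictly larger height; i.e., there exists exactly one volume-one ellipsoid E ⊆ C with the property that for every volume-one ellipsoid E′ ⊆ C with E′ ≠ E, the height of E′ is strictly greater than the height of E. -/
open MeasureTheory

/-- An ellipsoid is the image of the closed Euclidean unit ball under an
invertible affine transformation. -/
def IsEllipsoid {d : ℕ} (E : Set (EuclideanSpace ℝ (Fin d))) : Prop :=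
  ∃ L : EuclideanSpace ℝ (Fin d) ≃ᵃ[ℝ] EuclideanSpace ℝ (Fin d),
    E = L '' Metric.closedBall 0 1

/-- The height of a set: the supremum of the last coordinate over its points. -/
noncomputable def height {d : ℕ} (hd : 0 < d)
    (E : Set (EuclideanSpace ℝ (Fin d))) : ℝ :=
  sSup ((fun x : EuclideanSpace ℝ (Fin d) => x ⟨d - 1, Nat.sub_lt hd Nat.one_pos⟩) '' E)

open Metric Module

section Ellipsoids

variable {V : Type*} [NormedAddCommGroup V] [InnerProductSpace ℝ V]

/-- The image of the closed unit ball under the affine map `x ↦ c + M x`. -/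
def affBall (c : V) (M : V →ₗ[ℝ] V) : Set V :=
  (fun x => c + M x) '' closedBall 0 1

lemma affBall_subset_iff {c : V} {M : V →ₗ[ℝ] V} {D : Set V} :
    affBall c M ⊆ D ↔ ∀ x : V, ‖x‖ ≤ 1 → c + M x ∈ D := by
  simp [affBall, Set.subset_def]

lemma center_mem_affBall (c : V) (M : V →ₗ[ℝ] V) : c ∈ affBall c M :=
  ⟨0, by simp, by simp⟩

lemma isEllipsoid_iff_affBall {d : ℕ} {E : Set (EuclideanSpace ℝ (Fin d))} :
    IsEllipsoid E ↔ ∃ c M, LinearMap.det M ≠ 0 ∧ E = affBall c M := by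
  constructor
  · rintro ⟨L, rfl⟩
    refine ⟨L 0, L.linear.toLinearMap, (LinearEquiv.isUnit_det' L.linear).ne_zero, ?_⟩
    refine Set.image_congr fun x _ => ?_
    have := L.map_vadd 0 x
    simp only [vadd_eq_add, add_zero] at this
    simp [this, add_comm]
  · rintro ⟨c, M, hM, rfl⟩
    exact ⟨(M.equivOfDetNeZero hM).toAffineEquiv.trans (AffineEquiv.constVAdd ℝ _ c), rfl⟩

section Measure

variable [FiniteDimensional ℝ V] [MeasurableSpace V] [BorelSpace V]
  (μ : Measure V) [μ.IsAddHaarMeasure]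

lemma measure_affBall (c : V) (M : V →ₗ[ℝ] V) :
    μ (affBall c M) = ENNReal.ofReal |LinearMap.det M| * μ (closedBall 0 1) := by
  rw [← Measure.addHaar_image_linearMap, ← measure_vadd μ c (M '' _), affBall,
    ← Set.image_vadd, Set.image_image]
  rfl

lemma measure_affBall_eq_iff (c c' : V) (M M' : V →ₗ[ℝ] V) :
    μ (affBall c M) = μ (affBall c' M') ↔ |LinearMap.det M| = |LinearMap.det M'| := by
  rw [measure_affBall, measure_affBall,
    ENNReal.mul_left_inj (measure_closedBall_pos μ 0 one_pos).ne' measure_closedBall_lt_top.ne,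
    ENNReal.ofReal_eq_ofReal_iff (abs_nonneg _) (abs_nonneg _)]

end Measure

section Diagonal

variable {ι : Type*} [Fintype ι] [DecidableEq ι]

/-- The operator scaling the `i`-th vector of an orthonormal basis by `s i`. -/
noncomputable def scaling (b : OrthonormalBasis ι ℝ V) (s : ι → ℝ) : V →ₗ[ℝ] V :=
  Matrix.toLin b.toBasis b.toBasis (Matrix.diagonal s)

lemma det_scaling (b : OrthonormalBasis ι ℝ V) (s : ι → ℝ) :
    LinearMap.det (scaling b s) = ∏ i, s i := by
  rw [scaling, LinearMap.det_toLin, Matrix.det_diagonal]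

lemma scaling_apply (b : OrthonormalBasis ι ℝ V) (s : ι → ℝ) (x : V) :
    scaling b s x = ∑ i, (s i * b.repr x i) • b i := by
  rw [scaling, Matrix.toLin_apply]
  simp [Matrix.mulVec_diagonal]

lemma scaling_one (b : OrthonormalBasis ι ℝ V) : scaling b (fun _ => 1) = LinearMap.id := by
  rw [scaling, Matrix.diagonal_one, Matrix.toLin_one]

lemma repr_scaling (b : OrthonormalBasis ι ℝ V) (s : ι → ℝ) (x : V) (i : ι) :
    b.repr (scaling b s x) i = s i * b.repr x i := by
  rw [scaling_apply]
  simp [Pi.single_apply]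

end Diagonal

/-- The image of the unit ball under an invertible operator is also its image under an operator
that is positive and diagonal in a suitable orthonormal basis. -/
lemma exists_scaling_image_eq [FiniteDimensional ℝ V] (N : V ≃ₗ[ℝ] V) :
    ∃ (b : OrthonormalBasis (Fin (finrank ℝ V)) ℝ V) (s : Fin (finrank ℝ V) → ℝ),
      (∀ i, 0 < s i) ∧ N '' closedBall 0 1 = scaling b s '' closedBall 0 1 := by
  set T : V →ₗ[ℝ] V := N.symm.toLinearMap
  have hT : (LinearMap.adjoint T * T).IsSymmetric := T.isSymmetric_adjoint_mul_self
  set b := hT.eigenvectorBasis rfl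
  set m := hT.eigenvalues rfl
  have hm : ∀ i, 0 < m i := by
    intro i
    have h1 : inner ℝ ((LinearMap.adjoint T * T) (b i)) (b i) = m i := by
      rw [hT.apply_eigenvectorBasis rfl i]
      simp [inner_smul_left, b, m]
    rw [← h1, Module.End.mul_apply, LinearMap.adjoint_inner_left, real_inner_self_eq_norm_sq]
    have : T (b i) ≠ 0 := by
      simpa [T] using b.orthonormal.ne_zero i
    positivity
  have hnorm : ∀ y, ‖T y‖ ^ 2 = ∑ i, m i * b.repr y i ^ 2 := by
    intro y
    rw [← real_inner_self_eq_norm_sq, ← LinearMap.adjoint_inner_left, ← Module.End.mul_apply,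
      ← b.repr.inner_map_map, PiLp.inner_apply]
    refine Finset.sum_congr rfl fun i _ => ?_
    rw [hT.eigenvectorBasis_apply_self_apply rfl]
    simp [b, m]
    ring
  refine ⟨b, fun i => (√(m i))⁻¹, fun i => by have := hm i; positivity, ?_⟩
  have hs : ∀ y, scaling b (fun i => (√(m i))⁻¹) (scaling b (fun i => √(m i)) y) = y := by
    intro y
    apply b.repr.injective
    ext i
    have := (Real.sqrt_pos.2 (hm i)).ne'
    rw [repr_scaling, repr_scaling, inv_mul_cancel_left₀ this]
  have hTs : ∀ y, ‖T (scaling b (fun i => (√(m i))⁻¹) y)‖ = ‖y‖ := by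
    intro y
    rw [← sq_eq_sq₀ (norm_nonneg _) (norm_nonneg _), hnorm, ← b.repr.norm_map,
      EuclideanSpace.norm_sq_eq]
    refine Finset.sum_congr rfl fun i _ => ?_
    have := (hm i).ne'
    rw [repr_scaling, mul_pow, inv_pow, Real.sq_sqrt (hm i).le, mul_inv_cancel_left₀ this,
      Real.norm_eq_abs, sq_abs]
  ext y
  constructor
  · rintro ⟨x, hx, rfl⟩
    refine ⟨_, ?_, hs (N x)⟩
    rw [mem_closedBall_zero_iff, ← hTs, hs]
    simpa [T] using hx
  · rintro ⟨x, hx, rfl⟩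
    refine ⟨T (scaling b (fun i => (√(m i))⁻¹) x), ?_, by simp [T]⟩
    rw [mem_closedBall_zero_iff, hTs]
    simpa using hx

lemma one_lt_prod_half_one_add {ι : Type*} [Fintype ι] {s : ι → ℝ} (hs : ∀ i, 0 < s i)
    (hprod : ∏ i, s i = 1) (hne : ∃ i, s i ≠ 1) : 1 < ∏ i, (1 + s i) / 2 := by
  have h : ∏ i, s i < ∏ i, ((1 + s i) / 2) ^ 2 := by
    refine Finset.prod_lt_prod (fun i _ => hs i)
      (fun i _ => by nlinarith [sq_nonneg (1 - s i)]) ?_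
    obtain ⟨i, hi⟩ := hne
    exact ⟨i, Finset.mem_univ i, by nlinarith [sq_pos_of_ne_zero (sub_ne_zero.2 hi)]⟩
  rw [hprod, Finset.prod_pow] at h
  exact (one_lt_sq_iff₀ (Finset.prod_nonneg fun i _ => by linarith [hs i])).1 h

/-- A convex set containing two distinct translates of an ellipsoid contains an ellipsoid of
larger volume. -/
lemma exists_larger_of_translate [FiniteDimensional ℝ V] {D : Set V} (hD : Convex ℝ D)
    {c c' : V} (A : V ≃ₗ[ℝ] V) (h : affBall c A.toLinearMap ⊆ D)
    (h' : affBall c' A.toLinearMap ⊆ D) (hne : c ≠ c') :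
    ∃ p M, affBall p M ⊆ D ∧ |LinearMap.det A.toLinearMap| < |LinearMap.det M| := by
  rw [affBall_subset_iff] at h h'
  set w := A.symm (c' - c) with hw
  have hw0 : w ≠ 0 := by simpa [hw, sub_eq_zero] using hne.symm
  have hn : 0 < ‖w‖ := norm_pos_iff.2 hw0
  set ε := (2 * ‖w‖)⁻¹ with hε
  have hεn : ε * ‖w‖ = 1 / 2 := by rw [hε]; field_simp
  set τ := LinearMap.transvection (ε • (innerSL ℝ w : V →ₗ[ℝ] ℝ)) w with hτ
  refine ⟨c + A ((1 / 2 : ℝ) • w), A.toLinearMap ∘ₗ τ, ?_, ?_⟩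
  · rw [affBall_subset_iff]
    intro x hx
    set t := 1 / 2 + ε * inner ℝ w x with ht
    have habs : |ε * inner ℝ w x| ≤ 1 / 2 := by
      rw [abs_mul, abs_of_pos (by positivity : 0 < ε), ← hεn]
      gcongr
      exact (abs_real_inner_le_norm w x).trans (mul_le_of_le_one_right hn.le hx)
    rw [abs_le] at habs
    convert hD (h x hx) (h' x hx) (by linarith : 0 ≤ 1 - t) (by linarith : 0 ≤ t)
      (by ring) using 1
    have hc : c' = c + A w := by simp [hw]
    simp only [hτ, hc, LinearMap.comp_apply, LinearEquiv.coe_coe, LinearMap.transvection.apply,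
      LinearMap.smul_apply, map_add, map_smul, ContinuousLinearMap.coe_coe, innerSL_apply_apply,
      smul_eq_mul]
    module
  · have hdet : LinearMap.det τ = 1 + ‖w‖ / 2 := by
      rw [hτ, LinearMap.transvection.det]
      simp only [LinearMap.smul_apply, ContinuousLinearMap.coe_coe, innerSL_apply_apply,
        smul_eq_mul, real_inner_self_eq_norm_sq]
      linear_combination ‖w‖ * hεn
    rw [LinearMap.det_comp, abs_mul, hdet, abs_of_pos (by positivity : 0 < 1 + ‖w‖ / 2)]
    exact lt_mul_of_one_lt_right (abs_pos.2 (LinearEquiv.isUnit_det' A).ne_zero) (by linarith)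

/-- A convex set containing two distinct ellipsoids of equal volume contains an ellipsoid of
larger volume. -/
lemma exists_larger [FiniteDimensional ℝ V] {D : Set V} (hD : Convex ℝ D)
    {c₁ c₂ : V} (A₁ A₂ : V ≃ₗ[ℝ] V) (h₁ : affBall c₁ A₁.toLinearMap ⊆ D)
    (h₂ : affBall c₂ A₂.toLinearMap ⊆ D)
    (hdet : |LinearMap.det A₂.toLinearMap| = |LinearMap.det A₁.toLinearMap|)
    (hne : affBall c₁ A₁.toLinearMap ≠ affBall c₂ A₂.toLinearMap) :
    ∃ p M, affBall p M ⊆ D ∧ |LinearMap.det A₁.toLinearMap| < |LinearMap.det M| := by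
  obtain ⟨b, s, hs, hb⟩ := exists_scaling_image_eq (A₂.trans A₁.symm)
  have hE₂ : affBall c₂ A₂.toLinearMap = affBall c₂ (A₁.toLinearMap ∘ₗ scaling b s) := by
    have := congrArg (fun S => (fun x => c₂ + A₁ x) '' S) hb
    simpa [Set.image_image, affBall] using this
  have hA₁ : 0 < |LinearMap.det A₁.toLinearMap| :=
    abs_pos.2 (LinearEquiv.isUnit_det' A₁).ne_zero
  have hprod : ∏ i, s i = 1 := by
    borelize V
    have := (measure_affBall_eq_iff (Measure.addHaar : Measure V) _ _ _ _).1 (congrArg _ hE₂)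
    rw [hdet, LinearMap.det_comp, abs_mul, det_scaling,
      abs_of_pos (Finset.prod_pos fun i _ => hs i)] at this
    exact (mul_right_eq_self₀.1 this.symm).resolve_right hA₁.ne'
  rw [hE₂] at h₂ hne
  by_cases hone : ∀ i, s i = 1
  · have hid : A₁.toLinearMap ∘ₗ scaling b s = A₁.toLinearMap := by
      rw [funext hone, scaling_one, LinearMap.comp_id]
    rw [hid] at h₂ hne
    exact exists_larger_of_translate hD A₁ h₁ h₂ fun h => hne (by rw [h])
  · push Not at hone
    refine ⟨(1 / 2 : ℝ) • c₁ + (1 / 2 : ℝ) • c₂,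
      A₁.toLinearMap ∘ₗ scaling b (fun i => (1 + s i) / 2), ?_, ?_⟩
    · rw [affBall_subset_iff] at h₁ h₂ ⊢
      intro x hx
      have key : scaling b (fun i => (1 + s i) / 2) x
          = (1 / 2 : ℝ) • x + (1 / 2 : ℝ) • scaling b s x := by
        apply b.repr.injective
        ext i
        simp only [repr_scaling, map_add, map_smul, PiLp.add_apply, PiLp.smul_apply, smul_eq_mul]
        ring
      convert hD (h₁ x hx) (h₂ x hx) (by norm_num : (0 : ℝ) ≤ 1 / 2)
        (by norm_num : (0 : ℝ) ≤ 1 / 2) (by norm_num) using 1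
      simp only [LinearMap.comp_apply, key, map_add, map_smul]
      module
    · have h := one_lt_prod_half_one_add hs hprod hone
      rw [LinearMap.det_comp, abs_mul, det_scaling, abs_of_pos (one_pos.trans h)]
      exact lt_mul_of_one_lt_right hA₁ h

/-- An ellipsoid can be shrunk about its center to any smaller volume, which lowers the maximum
of every nonzero linear functional. -/
lemma exists_lower [FiniteDimensional ℝ V] {D : Set V} (hD : Convex ℝ D) {l : V →ₗ[ℝ] ℝ}
    (hl : l ≠ 0) {h v : ℝ} (hv : 0 < v) {c : V} {M : V →ₗ[ℝ] V}
    (hM : affBall c M ⊆ D) (hh : ∀ x ∈ affBall c M, l x ≤ h) (hvM : v < |LinearMap.det M|) :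
    ∃ M', affBall c M' ⊆ D ∧ |LinearMap.det M'| = v ∧ ∃ h' < h, ∀ x ∈ affBall c M', l x ≤ h' := by
  have hdet : 0 < |LinearMap.det M| := hv.trans hvM
  obtain ⟨z, hz⟩ : ∃ z, l z ≠ 0 := by
    by_contra! H
    exact hl (LinearMap.ext H)
  have hfin : finrank ℝ V ≠ 0 := by
    have : Nontrivial V := ⟨z, 0, fun H => hz (by simp [H])⟩
    exact finrank_pos.ne'
  set t := (v / |LinearMap.det M|) ^ ((finrank ℝ V : ℝ)⁻¹) with ht
  have hq : v / |LinearMap.det M| < 1 := (div_lt_one hdet).2 hvM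
  have ht0 : 0 < t := by positivity
  have ht1 : t < 1 := Real.rpow_lt_one (by positivity) hq (by positivity)
  have htp : t ^ finrank ℝ V = v / |LinearMap.det M| :=
    Real.rpow_inv_natCast_pow (by positivity) hfin
  have hc : l c < h := by
    set A := M.equivOfDetNeZero (abs_pos.1 hdet)
    set u := A.symm (l z • z)
    have hu : u ≠ 0 := by
      have : z ≠ 0 := fun H => hz (by simp [H])
      simp [u, hz, this]
    have hMu : M u = l z • z := A.apply_symm_apply _
    have := hh _ ⟨‖u‖⁻¹ • u, by simp [norm_smul, hu], rfl⟩
    simp only [map_add, map_smul, hMu, smul_eq_mul] at this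
    have : 0 < ‖u‖⁻¹ * (l z * l z) :=
      mul_pos (inv_pos.2 (norm_pos_iff.2 hu)) (mul_self_pos.2 hz)
    linarith
  have hcomb : ∀ x, c + (t • M) x = (1 - t) • c + t • (c + M x) := by
    intro x
    simp only [LinearMap.smul_apply]
    module
  refine ⟨t • M, ?_, ?_, (1 - t) * l c + t * h, by nlinarith, ?_⟩
  · rw [affBall_subset_iff]
    intro x hx
    rw [hcomb]
    exact hD (hM (center_mem_affBall c M)) (affBall_subset_iff.1 hM x hx) (by linarith) ht0.le
      (by ring)
  · rw [LinearMap.det_smul, abs_mul, htp, abs_of_pos (by positivity), div_mul_cancel₀ _ hdet.ne']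
  · rintro _ ⟨x, hx, rfl⟩
    have := hh _ ⟨x, hx, rfl⟩
    simp only [hcomb, map_add, map_smul, smul_eq_mul] at this ⊢
    nlinarith

/-- Among the ellipsoids of given volume in a compact set there is one minimizing the maximum of a
given linear functional. -/
lemma exists_lowest [FiniteDimensional ℝ V] {C : Set V} (hC : IsCompact C) (l : V →L[ℝ] ℝ)
    {v : ℝ} (hne : ∃ c M, affBall c M ⊆ C ∧ |LinearMap.det M| = v) :
    ∃ c M, (affBall c M ⊆ C ∧ |LinearMap.det M| = v) ∧
      ∀ c' M', affBall c' M' ⊆ C → |LinearMap.det M'| = v →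
        sSup (l '' affBall c M) ≤ sSup (l '' affBall c' M') := by
  set K : Set (V × (V →L[ℝ] V)) :=
    {p | (∀ x : V, ‖x‖ ≤ 1 → p.1 + p.2 x ∈ C) ∧ |p.2.det| = v} with hK
  have hclosed : IsClosed K := by
    have : K = (⋂ (x : V) (_ : ‖x‖ ≤ 1), {p | p.1 + p.2 x ∈ C}) ∩ {p | |p.2.det| = v} := by
      ext p
      simp [hK]
    rw [this]
    refine (isClosed_iInter fun x => isClosed_iInter fun _ => ?_).inter ?_
    · exact hC.isClosed.preimage (by fun_prop)
    · exact isClosed_eq (ContinuousLinearMap.continuous_det.comp continuous_snd).abs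
        continuous_const
  obtain ⟨R, hR⟩ := hC.isBounded.exists_norm_le
  have hbdd : Bornology.IsBounded K := by
    refine isBounded_iff_forall_norm_le.2 ⟨2 * R, fun p hp => ?_⟩
    have h0 : ‖p.1‖ ≤ R := by simpa using hR _ (hp.1 0 (by simp))
    have hR0 : 0 ≤ R := (norm_nonneg _).trans h0
    refine (norm_prod_le_iff).2 ⟨by linarith, ?_⟩
    refine ContinuousLinearMap.opNorm_le_of_unit_norm (by positivity) fun x hx => ?_
    have := norm_sub_le (p.1 + p.2 x) p.1
    rw [add_sub_cancel_left] at this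
    linarith [hR _ (hp.1 x hx.le)]
  have hcont : Continuous fun p : V × (V →L[ℝ] V) =>
      sSup ((fun x => l (p.1 + p.2 x)) '' closedBall (0 : V) 1) :=
    (isCompact_closedBall (0 : V) 1).continuous_sSup
      (f := fun (p : V × (V →L[ℝ] V)) x => l (p.1 + p.2 x)) (by
        change Continuous fun q : (V × (V →L[ℝ] V)) × V => l (q.1.1 + q.1.2 q.2)
        fun_prop)
  have hKc : IsCompact K := isCompact_of_isClosed_isBounded hclosed hbdd
  have hmem : ∀ c M, affBall c M ⊆ C → |LinearMap.det M| = v →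
      (c, LinearMap.toContinuousLinearMap M) ∈ K := fun c M h h' =>
    ⟨affBall_subset_iff.1 h, by simpa using h'⟩
  obtain ⟨c, M, h, h'⟩ := hne
  obtain ⟨p, hp, hmin⟩ := hKc.exists_isMinOn ⟨_, hmem c M h h'⟩ hcont.continuousOn
  refine ⟨p.1, p.2, ⟨affBall_subset_iff.2 hp.1, hp.2⟩, fun c' M' h h' => ?_⟩
  simpa [affBall, Set.image_image] using hmin (hmem c' M' h h')

end Ellipsoids

/-- Uniqueness of the lowest ellipsoid. -/
theorem lowest_ellipsoid_unique
    (d : ℕ) (hd : 0 < d) (C : Set (EuclideanSpace ℝ (Fin d)))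
    (hconv : Convex ℝ C) (hcpt : IsCompact C) (hint : (interior C).Nonempty)
    (hE : ∃ E, IsEllipsoid E ∧ volume E = 1 ∧ E ⊆ C) :
    ∃! E : Set (EuclideanSpace ℝ (Fin d)),
      (IsEllipsoid E ∧ volume E = 1 ∧ E ⊆ C) ∧
      ∀ E' : Set (EuclideanSpace ℝ (Fin d)),
        IsEllipsoid E' → volume E' = 1 → E' ⊆ C → E' ≠ E →
          height hd E < height hd E' := by
  set l : EuclideanSpace ℝ (Fin d) →L[ℝ] ℝ :=
    EuclideanSpace.proj ⟨d - 1, Nat.sub_lt hd Nat.one_pos⟩ with hl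
  have hheight : ∀ E, height hd E = sSup (l '' E) := fun _ => rfl
  have hl0 : l.toLinearMap ≠ 0 := fun H => by
    have := LinearMap.congr_fun H
      (EuclideanSpace.single ⟨d - 1, Nat.sub_lt hd Nat.one_pos⟩ (1 : ℝ))
    simp [hl] at this
  have hle : ∀ E ⊆ C, ∀ x ∈ E, l x ≤ height hd E := fun E hEC x hx =>
    le_csSup ((hcpt.image l.continuous).bddAbove.mono (Set.image_mono hEC)) ⟨x, hx, rfl⟩
  obtain ⟨E₀, hE₀, hvol₀, hsub₀⟩ := hE
  obtain ⟨c₀, M₀, hM₀, rfl⟩ := isEllipsoid_iff_affBall.1 hE₀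
  set v := |LinearMap.det M₀| with hv
  have hv0 : 0 < v := abs_pos.2 hM₀
  have hvol : ∀ c M, volume (affBall c M) = 1 ↔ |LinearMap.det M| = v := fun c M => by
    rw [← hvol₀, measure_affBall_eq_iff]
  obtain ⟨c, M, ⟨hsub, hdet⟩, hmin⟩ := exists_lowest hcpt l ⟨c₀, M₀, hsub₀, rfl⟩
  have hM : LinearMap.det M ≠ 0 := abs_pos.1 (hdet ▸ hv0)
  have hmain : (IsEllipsoid (affBall c M) ∧ volume (affBall c M) = 1 ∧ affBall c M ⊆ C) ∧
      ∀ E', IsEllipsoid E' → volume E' = 1 → E' ⊆ C → E' ≠ affBall c M →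
        height hd (affBall c M) < height hd E' := by
    refine ⟨⟨isEllipsoid_iff_affBall.2 ⟨c, M, hM, rfl⟩, (hvol c M).2 hdet, hsub⟩, ?_⟩
    intro E' hE' hvol' hsub' hne
    obtain ⟨c', M', hM', rfl⟩ := isEllipsoid_iff_affBall.1 hE'
    have hdet' := (hvol c' M').1 hvol'
    by_contra! hcon
    set h := height hd (affBall c M)
    obtain ⟨p, N, hN, hlt⟩ := exists_larger
      (hconv.inter (convex_halfSpace_le l.toLinearMap.isLinear h))
      (M.equivOfDetNeZero hM) (M'.equivOfDetNeZero hM')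
      (fun x hx => ⟨hsub hx, hle _ hsub x hx⟩)
      (fun x hx => ⟨hsub' hx, (hle _ hsub' x hx).trans hcon⟩)
      (hdet'.trans hdet.symm) hne.symm
    obtain ⟨N', hN', hdetN, h', hh', hlow⟩ := exists_lower hconv hl0 hv0
      (fun x hx => (hN hx).1) (fun x hx => (hN hx).2) (hdet.symm.trans_lt hlt)
    refine (hmin p N' hN' hdetN).not_gt (lt_of_le_of_lt ?_ hh')
    refine csSup_le ⟨_, p, center_mem_affBall p N', rfl⟩ ?_
    rintro _ ⟨x, hx, rfl⟩
    exact hlow x hx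
  refine ⟨affBall c M, hmain, fun E hE => ?_⟩
  by_contra hne
  exact (hmain.2 E hE.1.1 hE.1.2.1 hE.1.2.2 hne).asymm
    (hE.2 _ hmain.1.1 hmain.1.2.1 hmain.1.2.2 (Ne.symm hne))
end

section
/- Quantitative Tverberg Theorem: For every dimension d ≥ 1 and integer r ≥ 1, if m ≥ (r−1)·(d(d+3)/2 + 1) + 1 and E₁, …, E_m is a (multi)family of ellipsoids in ℝ^d each of volume one, then there is a partition {1,…,m} = I₁ ∪ … ∪ I_r into r pairwise disjoint parts such that the intersection ⋂_{i=1}^{r} conv(⋃_{j ∈ Iᵢ} E_j) contains an ellipsoid of volume one. -/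
open MeasureTheory

open scoped RealInnerProductSpace

theorem inner_sub_nonneg_of_norm_le_segment {F : Type*} [NormedAddCommGroup F]
    [InnerProductSpace ℝ F] {x z : F}
    (h : ∀ t : ℝ, 0 ≤ t → t ≤ 1 → ‖z‖ ≤ ‖z + t • (x - z)‖) : 0 ≤ ⟪z, x - z⟫ := by
  by_contra! ha
  set a := ⟪z, x - z⟫ with ha_def
  have hb : 0 ≤ ‖x - z‖ ^ 2 := sq_nonneg _
  set b := ‖x - z‖ ^ 2 with hb_def
  have hba : 0 < b - a := by linarith
  have ht0 : 0 < -a / (b - a) := div_pos (by linarith) hba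
  have ht1 : -a / (b - a) ≤ 1 := (div_le_one hba).2 (by linarith)
  have hle := pow_le_pow_left₀ (norm_nonneg z) (h _ ht0.le ht1) 2
  rw [norm_add_sq_real, inner_smul_right, norm_smul, mul_pow, ← ha_def, ← hb_def,
    Real.norm_eq_abs, sq_abs] at hle
  set t := -a / (b - a) with ht
  have htb : t * (b - a) = -a := div_mul_cancel₀ _ hba.ne'
  nlinarith

/-- If the weights `w` represent a point `z` as a convex combination of more points than the
dimension, all lying on the hyperplane `⟪·, z⟫ = ‖z‖ ^ 2`, some point can be dropped. -/
theorem exists_stdSimplex_zero_weight {F ι : Type*} [NormedAddCommGroup F]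
    [InnerProductSpace ℝ F] [FiniteDimensional ℝ F] [Fintype ι]
    (hcard : Module.finrank ℝ F < Fintype.card ι) {y : ι → F} {w : ι → ℝ} {z : F} (hz : z ≠ 0)
    (hw : w ∈ stdSimplex ℝ ι) (hwz : ∑ j, w j • y j = z) (hy : ∀ j, ⟪y j, z⟫ = ‖z‖ ^ 2) :
    ∃ v ∈ stdSimplex ℝ ι, ∑ j, v j • y j = z ∧ ∃ j, v j = 0 := by
  have hdep : ¬ LinearIndependent ℝ y := fun h =>
    absurd h.fintype_card_le_finrank (not_le.2 hcard)
  obtain ⟨c, hc, i₀, hi₀⟩ := Fintype.not_linearIndependent_iff.1 hdep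
  have hcsum : ∑ j, c j = 0 := by
    have := congrArg (fun v => ⟪v, z⟫) hc
    simp only [sum_inner, inner_smul_left, hy, inner_zero_left, ← Finset.sum_mul] at this
    simpa [hz] using this
  obtain ⟨i₁, -, hi₁⟩ : ∃ i ∈ Finset.univ, 0 < c i :=
    Finset.exists_pos_of_sum_zero_of_exists_nonzero c hcsum ⟨i₀, Finset.mem_univ _, hi₀⟩
  obtain ⟨j, hj, hjmin⟩ := Finset.exists_min_image (Finset.univ.filter fun i => 0 < c i)
    (fun i => w i / c i) ⟨i₁, by simpa using hi₁⟩
  simp only [Finset.mem_filter, Finset.mem_univ, true_and] at hj hjmin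
  have ht : 0 ≤ w j / c j := div_nonneg (hw.1 j) hj.le
  refine ⟨fun i => w i - w j / c j * c i, ⟨fun i => ?_, ?_⟩, ?_, j, ?_⟩
  · rcases le_or_gt (c i) 0 with hci | hci
    · have := mul_nonneg_of_nonpos_of_nonpos (neg_nonpos.2 ht) hci
      have := hw.1 i
      linarith
    · have := (le_div_iff₀ hci).1 (hjmin i hci)
      linarith
  · simp only [Finset.sum_sub_distrib, ← Finset.mul_sum, hcsum, hw.2, mul_zero, sub_zero]
  · simp only [sub_smul, mul_smul, Finset.sum_sub_distrib, ← Finset.smul_sum, hc, hwz, smul_zero,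
      sub_zero]
  · simp [div_mul_cancel₀ _ hj.ne']

/-- Bárány's colorful Carathéodory theorem, for color classes summing to zero. -/
theorem colorful_caratheodory {F ι κ : Type*} [NormedAddCommGroup F] [InnerProductSpace ℝ F]
    [FiniteDimensional ℝ F] [Fintype ι] [Fintype κ] [Nonempty κ]
    (hcard : Module.finrank ℝ F < Fintype.card ι) (x : ι → κ → F) (hx : ∀ j, ∑ i, x j i = 0) :
    ∃ f : ι → κ, ∃ w ∈ stdSimplex ℝ ι, ∑ j, w j • x j (f j) = 0 := by
  classical
  have hne : Nonempty ι := Fintype.card_pos_iff.1 (by omega)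
  let P : (ι → κ) → (ι → ℝ) → F := fun f w => ∑ j, w j • x j (f j)
  have hmin : ∀ f, ∃ w ∈ stdSimplex ℝ ι, ∀ v ∈ stdSimplex ℝ ι, ‖P f w‖ ≤ ‖P f v‖ := fun f =>
    (isCompact_stdSimplex ℝ ι).exists_isMinOn ⟨_, single_mem_stdSimplex ℝ (Classical.arbitrary ι)⟩
      (f := fun w => ‖P f w‖) (by fun_prop)
  choose W hW hWmin using hmin
  obtain ⟨f, hf⟩ := Finite.exists_min fun f => ‖P f (W f)‖
  have hglob : ∀ g, ∀ v ∈ stdSimplex ℝ ι, ‖P f (W f)‖ ≤ ‖P g v‖ := fun g v hv =>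
    (hf g).trans (hWmin g v hv)
  refine ⟨f, W f, hW f, ?_⟩
  by_contra hz
  set z := P f (W f) with hz_def
  change z ≠ 0 at hz
  have hinner : ∀ g, ∀ w ∈ stdSimplex ℝ ι, P g w = z → ∀ j, ‖z‖ ^ 2 ≤ ⟪x j (g j), z⟫ := by
    intro g w hw hwz j
    have hPj : P g (Pi.single j 1) = x j (g j) := by
      simp [P]
    have hlin : ∀ t : ℝ, z + t • (x j (g j) - z) = P g (w + t • (Pi.single j 1 - w)) := by
      intro t
      rw [← hPj, ← hwz]
      simp only [P, Pi.add_apply, Pi.smul_apply, Pi.sub_apply, add_smul, sub_smul, smul_eq_mul,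
        mul_smul, Finset.sum_add_distrib, Finset.sum_sub_distrib, ← Finset.smul_sum]
    have := inner_sub_nonneg_of_norm_le_segment (x := x j (g j)) (z := z) fun t ht0 ht1 => by
      rw [hlin]
      exact hglob g _ ((convex_stdSimplex ℝ ι).add_smul_sub_mem hw (single_mem_stdSimplex ℝ j)
        ⟨ht0, ht1⟩)
    rw [inner_sub_right, real_inner_self_eq_norm_sq, real_inner_comm] at this
    linarith
  obtain ⟨v, hv, hvz, j, hvj⟩ : ∃ v ∈ stdSimplex ℝ ι, P f v = z ∧ ∃ j, v j = 0 := by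
    by_cases h0 : ∃ j, W f j = 0
    · exact ⟨W f, hW f, rfl, h0⟩
    refine exists_stdSimplex_zero_weight hcard hz (hW f) rfl fun j => ?_
    have hsum : ∑ j, W f j * (⟪x j (f j), z⟫ - ‖z‖ ^ 2) = 0 := by
      simp only [mul_sub, Finset.sum_sub_distrib, ← Finset.sum_mul, (hW f).2, one_mul]
      rw [sub_eq_zero, ← real_inner_self_eq_norm_sq]
      conv_rhs => rw [hz_def]
      simp only [P, sum_inner, inner_smul_left]
      simp [hz_def, P]
    have := (Finset.sum_eq_zero_iff_of_nonneg fun j _ => mul_nonneg ((hW f).1 j)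
      (sub_nonneg.2 (hinner f _ (hW f) rfl j))).1 hsum j (Finset.mem_univ j)
    rcases mul_eq_zero.1 this with h | h
    · exact absurd ⟨j, h⟩ h0
    · linarith
  obtain ⟨i, -, hi⟩ : ∃ i ∈ Finset.univ, ⟪x j i, z⟫ ≤ 0 := by
    apply Finset.exists_le_of_sum_le Finset.univ_nonempty
    simp [← sum_inner, hx]
  have hvz' : P (Function.update f j i) v = z := by
    rw [← hvz]
    refine Finset.sum_congr rfl fun k _ => ?_
    by_cases hk : k = j
    · subst hk; simp [hvj]
    · simp [hk]
  have := hinner _ v hv hvz' j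
  simp only [Function.update_self] at this
  have : 0 < ‖z‖ ^ 2 := by positivity
  linarith

/-- Tverberg's theorem in coordinates, via Sarkaria's tensor method: the weights `w` witness a
common point of the convex hulls of the classes of the partition `f`. -/
theorem exists_tverberg_partition {ι κ : Type*} [Fintype ι] [Fintype κ] {r : ℕ} (hr : 1 ≤ r)
    (hcard : (r - 1) * (Fintype.card κ + 1) + 1 ≤ Fintype.card ι) (p : ι → κ → ℝ) :
    ∃ (f : ι → Fin r) (w : ι → ℝ) (c : κ → ℝ), (∀ j, 0 ≤ w j) ∧
      (∀ i, ∑ j with f j = i, w j = 1) ∧ ∀ i, ∑ j with f j = i, w j • p j = c := by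
  classical
  obtain ⟨k, rfl⟩ : ∃ k, r = k + 1 := ⟨r - 1, by omega⟩
  let q : ι → Option κ → ℝ := fun j o => o.elim 1 (p j)
  let x : ι → Fin (k + 1) → EuclideanSpace ℝ (Option κ × Fin k) := fun j i =>
    WithLp.toLp 2 fun a => q j a.1 *
      ((if i = a.2.castSucc then 1 else 0) - (if i = Fin.last k then 1 else 0))
  obtain ⟨f, w, hw, hsum⟩ := colorful_caratheodory (x := x)
    (by simp only [finrank_euclideanSpace, Fintype.card_prod, Fintype.card_option, Fintype.card_fin]
        rw [mul_comm]; simpa using hcard)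
    (fun j => by
      ext a
      simp [x, ← Finset.mul_sum, Finset.sum_sub_distrib])
  let S : Fin (k + 1) → Option κ → ℝ := fun i o => ∑ j with f j = i, w j * q j o
  have hlast : ∀ i, S i = S (Fin.last k) := by
    intro i
    refine Fin.lastCases rfl (fun l => ?_) i
    ext o
    have := congrArg (fun v => v (o, l)) hsum
    simp only [x, WithLp.ofLp_sum, WithLp.ofLp_smul, Finset.sum_apply, Pi.smul_apply, smul_eq_mul,
      mul_sub, mul_ite, mul_one, mul_zero, Finset.sum_sub_distrib, ← Finset.sum_filter,
      PiLp.zero_apply, sub_eq_zero] at this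
    exact this
  have hnone : ∀ i, S i none = ∑ j with f j = i, w j := fun i => by simp [S, q]
  have htot : (k + 1 : ℝ) * S (Fin.last k) none = 1 := by
    have h1 : ∑ i, S i none = 1 := by
      simp only [hnone]
      rw [Finset.sum_fiberwise, hw.2]
    simpa [hlast] using h1
  refine ⟨f, fun j => (k + 1 : ℝ) * w j, fun o => (k + 1 : ℝ) * S (Fin.last k) (some o),
    fun j => mul_nonneg (by positivity) (hw.1 j), fun i => ?_, fun i => ?_⟩
  · rw [← Finset.mul_sum, ← hnone, hlast, htot]
  · ext o
    rw [← hlast i]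
    simp [S, q, Finset.mul_sum, mul_assoc]

open scoped MatrixOrder in
theorem Matrix.PosDef.exists_posDef_mul_self_eq {n : Type*} [Fintype n] [DecidableEq n]
    {A : Matrix n n ℝ} (hA : A.PosDef) : ∃ R : Matrix n n ℝ, R.PosDef ∧ R * R = A := by
  have hmul := CFC.sqrt_mul_sqrt_self A hA.posSemidef.nonneg
  refine ⟨CFC.sqrt A, ?_, hmul⟩
  refine (Matrix.nonneg_iff_posSemidef.1 (CFC.sqrt_nonneg A)).posDef_iff_isUnit.2 ?_
  have := hA.isUnit
  rw [← hmul] at this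
  exact (IsUnit.mul_iff.1 this).1

theorem Matrix.PosDef.card_add_log_det_le_trace {n : Type*} [Fintype n] [DecidableEq n]
    {A : Matrix n n ℝ} (hA : A.PosDef) : Fintype.card n + Real.log A.det ≤ A.trace := by
  rw [hA.isHermitian.det_eq_prod_eigenvalues, hA.isHermitian.trace_eq_sum_eigenvalues]
  simp only [RCLike.ofReal_real_eq_id, id_eq]
  rw [Real.log_prod fun i _ => (hA.eigenvalues_pos i).ne']
  have := Finset.sum_le_sum fun i (_ : i ∈ Finset.univ) =>
    Real.log_le_sub_one_of_pos (hA.eigenvalues_pos i)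
  simp only [Finset.sum_sub_distrib, Finset.sum_const, Finset.card_univ, nsmul_eq_mul,
    mul_one] at this
  linarith

theorem Matrix.PosDef.card_add_log_det_le_trace_mul {n : Type*} [Fintype n] [DecidableEq n]
    {A B : Matrix n n ℝ} (hA : A.PosDef) (hB : B.PosDef) :
    Fintype.card n + Real.log (A.det * B.det) ≤ (A * B).trace := by
  obtain ⟨R, hR, rfl⟩ := hA.exists_posDef_mul_self_eq
  have hRBR : (R * B * R).PosDef := by
    have := (Matrix.IsUnit.posDef_star_left_conjugate_iff hR.isUnit).2 hB
    rwa [Matrix.star_eq_conjTranspose, hR.isHermitian.eq] at this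
  have := hRBR.card_add_log_det_le_trace
  rw [Matrix.trace_mul_comm, ← Matrix.mul_assoc] at this
  convert this using 3
  simp only [Matrix.det_mul]
  ring

/-- Superlevel sets of the determinant are convex on positive definite matrices. -/
theorem Matrix.le_det_sum_smul_of_posDef {n ι : Type*} [Fintype n] [DecidableEq n]
    {s : Finset ι} {w : ι → ℝ} {A : ι → Matrix n n ℝ} {c : ℝ} (hc : 0 < c)
    (hw : ∀ j ∈ s, 0 ≤ w j) (hsum : ∑ j ∈ s, w j = 1) (hA : ∀ j ∈ s, (A j).PosDef)
    (hdet : ∀ j ∈ s, c ≤ (A j).det) :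
    (∑ j ∈ s, w j • A j).PosDef ∧ c ≤ (∑ j ∈ s, w j • A j).det := by
  have hX : (∑ j ∈ s, w j • A j).PosDef := by
    obtain ⟨j, hj, hjpos⟩ : ∃ j ∈ s, 0 < w j := by
      apply Finset.exists_lt_of_sum_lt
      simp [hsum]
    classical
    rw [← Finset.add_sum_erase s _ hj]
    exact ((hA j hj).smul hjpos).add_posSemidef <| Matrix.posSemidef_sum _ fun i hi =>
      (hA i (Finset.mem_of_mem_erase hi)).posSemidef.smul (hw i (Finset.mem_of_mem_erase hi))
  refine ⟨hX, ?_⟩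
  set X := ∑ j ∈ s, w j • A j with hX_def
  have hdetX := hX.det_pos
  have hunit : IsUnit X.det := hdetX.ne'.isUnit
  have hlog : ∀ j ∈ s, w j * (Fintype.card n + Real.log (c / X.det)) ≤
      w j * (A j * X⁻¹).trace := fun j hj => by
    refine mul_le_mul_of_nonneg_left (le_trans ?_
      ((hA j hj).card_add_log_det_le_trace_mul hX.inv)) (hw j hj)
    rw [Matrix.det_nonsing_inv, Ring.inverse_eq_inv', ← div_eq_mul_inv]
    gcongr
    exact hdet j hj
  have htrace : ∑ j ∈ s, w j * (A j * X⁻¹).trace = Fintype.card n := by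
    rw [← Matrix.trace_one, ← Matrix.mul_nonsing_inv X hunit]
    conv_rhs => rw [hX_def, Finset.sum_mul, Matrix.trace_sum]
    simp [hX_def]
  have := Finset.sum_le_sum hlog
  rw [← Finset.sum_mul, hsum, htrace, one_mul, add_le_iff_nonpos_right] at this
  have := (Real.log_nonpos_iff (by positivity)).1 this
  exact (div_le_one hdetX).1 this

/-- Image of the unit ball under `v ↦ A v + a`. -/
def matrixEllipsoid {n : Type*} [Fintype n] [DecidableEq n] (A : Matrix n n ℝ)
    (a : EuclideanSpace ℝ n) : Set (EuclideanSpace ℝ n) :=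
  (fun v => A.toEuclideanLin v + a) '' Metric.closedBall 0 1

theorem volume_matrixEllipsoid {n : Type*} [Fintype n] [DecidableEq n] (A : Matrix n n ℝ)
    (a : EuclideanSpace ℝ n) :
    volume (matrixEllipsoid A a) =
      ENNReal.ofReal |A.det| * volume (Metric.closedBall (0 : EuclideanSpace ℝ n) 1) := by
  have : matrixEllipsoid A a = (· + a) '' (A.toEuclideanLin '' Metric.closedBall 0 1) := by
    rw [Set.image_image]; rfl
  rw [this, Set.image_add_right, measure_preimage_add_right, Measure.addHaar_image_linearMap,
    LinearMap.det_toLpLin]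

theorem isEllipsoid_matrixEllipsoid {d : ℕ} {A : Matrix (Fin d) (Fin d) ℝ} (hA : A.det ≠ 0)
    (a : EuclideanSpace ℝ (Fin d)) : IsEllipsoid (matrixEllipsoid A a) := by
  have hdet : LinearMap.det A.toEuclideanLin ≠ 0 := by rwa [LinearMap.det_toLpLin]
  refine ⟨(LinearMap.equivOfDetNeZero _ hdet).toAffineEquiv.trans
    (AffineEquiv.constVAdd ℝ _ a), ?_⟩
  refine Set.image_congr fun v _ => ?_
  simp [add_comm]

theorem norm_toEuclideanLin_of_mem_orthogonalGroup {n : Type*} [Fintype n] [DecidableEq n]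
    {U : Matrix n n ℝ} (hU : U ∈ Matrix.orthogonalGroup n ℝ) (v : EuclideanSpace ℝ n) :
    ‖U.toEuclideanLin v‖ = ‖v‖ := by
  have h : ‖U.toEuclideanLin v‖ ^ 2 = ‖v‖ ^ 2 := by
    rw [← real_inner_self_eq_norm_sq, ← LinearMap.adjoint_inner_left,
      ← Matrix.toEuclideanLin_conjTranspose_eq_adjoint, ← LinearMap.comp_apply,
      ← Matrix.toLpLin_mul_same, ← Matrix.star_eq_conjTranspose,
      Unitary.star_mul_self_of_mem hU]
    simp
  exact (pow_left_inj₀ (norm_nonneg _) (norm_nonneg _) two_ne_zero).1 h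

theorem toEuclideanLin_image_closedBall_of_mem_orthogonalGroup {n : Type*} [Fintype n]
    [DecidableEq n] {U : Matrix n n ℝ} (hU : U ∈ Matrix.orthogonalGroup n ℝ) :
    U.toEuclideanLin '' Metric.closedBall 0 1 = Metric.closedBall 0 1 := by
  ext v
  simp only [Set.mem_image, mem_closedBall_zero_iff]
  constructor
  · rintro ⟨u, hu, rfl⟩
    rwa [norm_toEuclideanLin_of_mem_orthogonalGroup hU]
  · intro hv
    refine ⟨(star U).toEuclideanLin v, ?_, ?_⟩
    · rwa [norm_toEuclideanLin_of_mem_orthogonalGroup (Unitary.star_mem hU)]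
    · rw [← LinearMap.comp_apply, ← Matrix.toLpLin_mul_same,
        Unitary.mul_star_self_of_mem hU]
      simp

/-- Left polar decomposition of an invertible real matrix. -/
theorem Matrix.exists_posDef_mul_orthogonal {n : Type*} [Fintype n] [DecidableEq n]
    {M : Matrix n n ℝ} (hM : IsUnit M) :
    ∃ P : Matrix n n ℝ, P.PosDef ∧ ∃ U ∈ Matrix.orthogonalGroup n ℝ, M = P * U := by
  have hMM : (M * star M).PosDef := by
    have := (Matrix.IsUnit.posDef_star_right_conjugate_iff hM).2 (Matrix.PosDef.one (R := ℝ))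
    rwa [mul_one] at this
  obtain ⟨P, hP, hPP⟩ := hMM.exists_posDef_mul_self_eq
  have hunit : IsUnit P.det := hP.det_pos.ne'.isUnit
  refine ⟨P, hP, P⁻¹ * M, ?_, (Matrix.mul_nonsing_inv_cancel_left _ _ hunit).symm⟩
  rw [Matrix.mem_unitaryGroup_iff, star_mul, Matrix.star_eq_conjTranspose P⁻¹,
    hP.inv.isHermitian.eq]
  calc P⁻¹ * M * (star M * P⁻¹) = P⁻¹ * (M * star M) * P⁻¹ := by simp only [Matrix.mul_assoc]
    _ = (P⁻¹ * P) * (P * P⁻¹) := by rw [← hPP]; simp only [Matrix.mul_assoc]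
    _ = 1 := by rw [Matrix.nonsing_inv_mul _ hunit, Matrix.mul_nonsing_inv _ hunit, mul_one]

theorem IsEllipsoid.exists_posDef {d : ℕ} {E : Set (EuclideanSpace ℝ (Fin d))}
    (hE : IsEllipsoid E) :
    ∃ (A : Matrix (Fin d) (Fin d) ℝ) (a : EuclideanSpace ℝ (Fin d)),
      A.PosDef ∧ E = matrixEllipsoid A a := by
  obtain ⟨L, rfl⟩ := hE
  let M : Matrix (Fin d) (Fin d) ℝ := Matrix.toEuclideanLin.symm L.linear.toLinearMap
  have hML : M.toEuclideanLin = L.linear.toLinearMap := LinearEquiv.apply_symm_apply _ _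
  have hM : IsUnit M := by
    rw [Matrix.isUnit_iff_isUnit_det, ← LinearMap.det_toLpLin 2, hML]
    exact L.linear.isUnit_det'
  obtain ⟨P, hP, U, hU, hPU⟩ := Matrix.exists_posDef_mul_orthogonal hM
  refine ⟨P, L 0, hP, ?_⟩
  conv_rhs => rw [matrixEllipsoid, ← toEuclideanLin_image_closedBall_of_mem_orthogonalGroup hU,
    Set.image_image]
  refine Set.image_congr fun v _ => ?_
  rw [← LinearMap.comp_apply, ← Matrix.toLpLin_mul_same, ← hPU, hML]
  simpa using L.map_vadd 0 v

/-- The Minkowski combination of ellipsoids lies in the convex hull of their union. -/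
theorem matrixEllipsoid_sum_smul_subset {n ι : Type*} [Fintype n] [DecidableEq n]
    {s : Finset ι} {w : ι → ℝ} (hw : ∀ j ∈ s, 0 ≤ w j) (hsum : ∑ j ∈ s, w j = 1)
    (A : ι → Matrix n n ℝ) (a : ι → EuclideanSpace ℝ n) :
    matrixEllipsoid (∑ j ∈ s, w j • A j) (∑ j ∈ s, w j • a j) ⊆
      convexHull ℝ (⋃ j ∈ s, matrixEllipsoid (A j) (a j)) := by
  rintro _ ⟨v, hv, rfl⟩
  have : (∑ j ∈ s, w j • A j).toEuclideanLin v + ∑ j ∈ s, w j • a j =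
      ∑ j ∈ s, w j • ((A j).toEuclideanLin v + a j) := by
    simp [map_sum, LinearMap.sum_apply, Finset.sum_add_distrib]
  simp only [this]
  exact (convex_convexHull ℝ _).sum_mem hw hsum fun j hj =>
    subset_convexHull ℝ _ (Set.mem_biUnion hj ⟨v, hv, rfl⟩)

theorem matrixEllipsoid_smul_subset {n : Type*} [Fintype n] [DecidableEq n] {t : ℝ} (ht0 : 0 ≤ t)
    (ht1 : t ≤ 1) (A : Matrix n n ℝ) (a : EuclideanSpace ℝ n) :
    matrixEllipsoid (t • A) a ⊆ matrixEllipsoid A a := by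
  rintro _ ⟨v, hv, rfl⟩
  refine ⟨t • v, ?_, by simp⟩
  rw [mem_closedBall_zero_iff] at hv ⊢
  rw [norm_smul, Real.norm_of_nonneg ht0]
  exact mul_le_one₀ ht1 (norm_nonneg v) hv

/-- Quantitative Tverberg Theorem. -/
theorem quantitative_tverberg
    (d : ℕ) (hd : 1 ≤ d) (r : ℕ) (hr : 1 ≤ r)
    (m : ℕ) (hm : (r - 1) * (d * (d + 3) / 2 + 1) + 1 ≤ m)
    (Es : Fin m → Set (EuclideanSpace ℝ (Fin d)))
    (hEs : ∀ j, IsEllipsoid (Es j) ∧ volume (Es j) = 1) :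
    ∃ f : Fin m → Fin r,
      ∃ E, IsEllipsoid E ∧ volume E = 1 ∧
        E ⊆ ⋂ i : Fin r, convexHull ℝ (⋃ j ∈ {j : Fin m | f j = i}, Es j) := by
  choose A a hA hEA using fun j => (hEs j).1.exists_posDef
  set V := volume (Metric.closedBall (0 : EuclideanSpace ℝ (Fin d)) 1) with hV
  have hV0 : V ≠ 0 := (Metric.measure_closedBall_pos volume _ one_pos).ne'
  have hVtop : V ≠ ⊤ := measure_closedBall_lt_top.ne
  set c : ℝ := V.toReal⁻¹ with hc_def
  have hc : 0 < c := inv_pos.2 (ENNReal.toReal_pos hV0 hVtop)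
  have hdet : ∀ j, (A j).det = c := fun j => by
    have h := (hEs j).2
    rw [hEA j, volume_matrixEllipsoid, abs_of_pos (hA j).det_pos] at h
    have := congrArg ENNReal.toReal h
    rw [ENNReal.toReal_mul, ENNReal.toReal_ofReal (hA j).det_pos.le, ENNReal.toReal_one] at this
    exact eq_inv_of_mul_eq_one_left this
  -- Coordinates of an ellipsoid: the entries of its symmetric matrix and of its center.
  let entry : Matrix (Fin d) (Fin d) ℝ → Sym2 (Fin d) → ℝ := fun B e => B e.inf e.sup
  have hentry : ∀ j k l, entry (A j) s(k, l) = A j k l := fun j k l => by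
    rcases le_total k l with h | h
    · simp [entry, h]
    · simpa [entry, h] using (hA j).isHermitian.apply k l
  let p : Fin m → Sym2 (Fin d) ⊕ Fin d → ℝ := fun j => Sum.elim (entry (A j)) (a j)
  have hcard : Fintype.card (Sym2 (Fin d) ⊕ Fin d) = d * (d + 3) / 2 := by
    rw [Fintype.card_sum, Sym2.card, Fintype.card_fin, Nat.choose_two_right, Nat.add_sub_cancel,
      ← Nat.add_mul_div_right _ _ two_pos]
    congr 1; ring
  obtain ⟨f, w, x, hw, hw1, hwx⟩ := exists_tverberg_partition hr (by simpa [hcard] using hm) p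
  let X : Matrix (Fin d) (Fin d) ℝ := fun k l => x (Sum.inl s(k, l))
  let b : EuclideanSpace ℝ (Fin d) := WithLp.toLp 2 fun k => x (Sum.inr k)
  have hX : ∀ i, ∑ j with f j = i, w j • A j = X := fun i => by
    ext k l
    simp [X, ← hwx i, p, hentry, Matrix.sum_apply]
  have hb : ∀ i, ∑ j with f j = i, w j • a j = b := fun i => by
    ext k
    simp [b, ← hwx i, p]
  obtain ⟨-, hXdet⟩ := Matrix.le_det_sum_smul_of_posDef hc (fun j _ => hw j) (hw1 ⟨0, hr⟩)
    (fun j _ => hA j) (fun j _ => (hdet j).ge)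
  rw [hX] at hXdet
  have hXpos : 0 < X.det := hc.trans_le hXdet
  set t : ℝ := (c / X.det) ^ (d : ℝ)⁻¹ with ht
  have hratio : 0 ≤ c / X.det := by positivity
  have htd : t ^ d = c / X.det := Real.rpow_inv_natCast_pow hratio (by omega)
  have ht0 : 0 ≤ t := Real.rpow_nonneg hratio _
  have ht1 : t ≤ 1 := Real.rpow_le_one hratio ((div_le_one hXpos).2 hXdet) (by positivity)
  have htX : (t • X).det = c := by
    rw [Matrix.det_smul, Fintype.card_fin, htd, div_mul_cancel₀ _ hXpos.ne']
  refine ⟨f, matrixEllipsoid (t • X) b, isEllipsoid_matrixEllipsoid (by rw [htX]; exact hc.ne') b,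
    ?_, Set.subset_iInter fun i => (matrixEllipsoid_smul_subset ht0 ht1 X b).trans ?_⟩
  · rw [volume_matrixEllipsoid, htX, abs_of_pos hc, ← hV, hc_def, ← ENNReal.toReal_inv,
      ENNReal.ofReal_toReal (ENNReal.inv_ne_top.2 hV0), ENNReal.inv_mul_cancel hV0 hVtop]
  · rw [← hX i, ← hb i]
    simpa [hEA] using
      matrixEllipsoid_sum_smul_subset (s := {j | f j = i}) (fun j _ => hw j) (hw1 i) A a
end

section
/- Quantitative Tverberg Theorem with equal parts: For every dimension d ≥ 1, set a = (d(d+3)/2 − 1)·(d(d+3)/2 + 1) + 1 and b = d(d+3)/2. If E₁, …, E_{ab} is a (multi)family of ab ellipsoids in ℝ^d each of volume one, then there is a partition {1,…,ab} = I₁ ∪ … ∪ I_b into b pairwise disjoint parts with |I₁| = … = |I_b| = a such that the intersection ⋂_{i=1}^{b} conv(⋃_{j ∈ Iᵢ} E_j) contains an ellipsoid of volume one. -/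
open MeasureTheory

open Module (finrank)

/-- **Centerpoint theorem**: some point stays in the convex hull of the family `x` after the
removal of any `m` members. -/
theorem exists_forall_mem_convexHull_image_compl {ι E : Type*} [Fintype ι] [DecidableEq ι]
    [AddCommGroup E] [Module ℝ E] [FiniteDimensional ℝ E] (x : ι → E) {m : ℕ}
    (hm : m * (finrank ℝ E + 1) < Fintype.card ι) :
    ∃ p, ∀ T : Finset ι, T.card ≤ m → p ∈ convexHull ℝ (x '' (T : Set ι)ᶜ) := by
  have key : (⋂ T ∈ Finset.univ.filter (fun T : Finset ι => T.card ≤ m),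
      convexHull ℝ (x '' (T : Set ι)ᶜ)).Nonempty := by
    refine Convex.helly_theorem' (𝕜 := ℝ) (fun _ _ => convex_convexHull ℝ _) fun I hI hcard => ?_
    have hle : (I.biUnion id).card ≤ (finrank ℝ E + 1) * m :=
      (Finset.card_biUnion_le_card_mul I id m fun T hT => (Finset.mem_filter.1 (hI hT)).2).trans
        (Nat.mul_le_mul_right _ hcard)
    obtain ⟨j, hj⟩ : ∃ j, j ∉ I.biUnion id := by
      by_contra! h
      rw [Finset.eq_univ_iff_forall.2 h, Finset.card_univ] at hle
      linarith
    refine ⟨x j, Set.mem_iInter₂.2 fun T hT => subset_convexHull ℝ _ ⟨j, fun hjT => hj ?_, rfl⟩⟩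
    exact Finset.mem_biUnion.2 ⟨T, hT, hjT⟩
  obtain ⟨p, hp⟩ := key
  exact ⟨p, fun T hT => Set.mem_iInter₂.1 hp T (by simpa using hT)⟩

/-- A functional that is constant on an affinely independent family of maximal size vanishes. -/
theorem AffineIndependent.eq_zero_of_forall_apply_eq {κ E : Type*} [Fintype κ]
    [AddCommGroup E] [Module ℝ E] [FiniteDimensional ℝ E] {z : κ → E}
    (hz : AffineIndependent ℝ z) (hcard : Fintype.card κ = finrank ℝ E + 1)
    {u : E →ₗ[ℝ] ℝ} {c : ℝ} (hu : ∀ k, u (z k) = c) : u = 0 := by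
  have htop := hz.affineSpan_eq_top_iff_card_eq_finrank_add_one.2 hcard
  have hall : ∀ y, u y = c := fun y => by
    have hy : y ∈ affineSpan ℝ (Set.range z) := htop ▸ AffineSubspace.mem_top ℝ E y
    have hle : affineSpan ℝ (Set.range z) ≤
        (AffineSubspace.mk' c (⊥ : Submodule ℝ ℝ)).comap u.toAffineMap := by
      rw [affineSpan_le]
      rintro _ ⟨k, rfl⟩
      simp [hu]
    simpa [sub_eq_zero] using hle hy
  ext y
  rw [hall y, ← hall 0, map_zero, LinearMap.zero_apply]

/-- A refinement of Carathéodory's theorem: a point in the convex hull of a family lies in the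
convex hull of at most `finrank + 1` members, of which at most `finrank` lie in any given closed
half-space with the point on its boundary. -/
theorem exists_finset_mem_convexHull_card_filter_le {ι E : Type*} [Fintype ι] [DecidableEq ι]
    [AddCommGroup E] [Module ℝ E] [FiniteDimensional ℝ E] (x : ι → E) {A : Set ι} {p : E}
    (hp : p ∈ convexHull ℝ (x '' A)) :
    ∃ S : Finset ι, (S : Set ι) ⊆ A ∧ p ∈ convexHull ℝ (x '' S) ∧ S.card ≤ finrank ℝ E + 1 ∧
      ∀ u : E →ₗ[ℝ] ℝ, u ≠ 0 → (S.filter fun j => u (x j) ≤ u p).card ≤ finrank ℝ E := by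
  obtain ⟨κ, _, z, w, hzA, hz, hw, hw1, hwp⟩ := eq_pos_convex_span_of_mem_convexHull hp
  choose g hgA hg using fun k => hzA ⟨k, rfl⟩
  have hginj : Function.Injective g := fun k l h => hz.injective (by rw [← hg k, ← hg l, h])
  have hcS : (Finset.univ.image g).card = Fintype.card κ := by
    rw [Finset.card_image_of_injective _ hginj, Finset.card_univ]
  have hcκ : Fintype.card κ ≤ finrank ℝ E + 1 :=
    hz.card_le_finrank_succ.trans (Nat.add_le_add_right (Submodule.finrank_le _) 1)
  refine ⟨Finset.univ.image g, ?_, ?_, hcS ▸ hcκ, fun u hu => ?_⟩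
  · intro j hj
    obtain ⟨k, -, rfl⟩ := Finset.mem_image.1 hj
    exact hgA k
  · rw [← hwp]
    refine (convex_convexHull ℝ _).sum_mem (fun k _ => (hw k).le) hw1 fun k _ => ?_
    exact subset_convexHull ℝ _ ⟨g k, by simp, hg k⟩
  · by_contra! hlt
    have hle := Finset.card_filter_le (Finset.univ.image g) fun j => u (x j) ≤ u p
    have hfilter : (Finset.univ.image g).filter (fun j => u (x j) ≤ u p) = Finset.univ.image g :=
      Finset.eq_of_subset_of_card_le (Finset.filter_subset _ _) (by omega)
    have hup : ∀ k, u (z k) ≤ u p := fun k => by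
      have := Finset.filter_eq_self.1 hfilter (g k) (by simp)
      rwa [hg k] at this
    have hsum : ∑ k, w k * (u p - u (z k)) = 0 := by
      simp only [mul_sub, Finset.sum_sub_distrib, ← Finset.sum_mul, hw1]
      rw [← hwp]
      simp
    have heq : ∀ k, u (z k) = u p := fun k => by
      have h0 := (Finset.sum_eq_zero_iff_of_nonneg fun k _ =>
        mul_nonneg (hw k).le (sub_nonneg.2 (hup k))).1 hsum k (Finset.mem_univ k)
      have := (mul_eq_zero.1 h0).resolve_left (hw k).ne'
      linarith
    exact hu (hz.eq_zero_of_forall_apply_eq (by omega) heq)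

/-- A Tverberg-type theorem, with parts of size at most `finrank + 1`. -/
theorem exists_disjoint_mem_convexHull {ι E : Type*} [Fintype ι] [DecidableEq ι]
    [NormedAddCommGroup E] [NormedSpace ℝ E] [FiniteDimensional ℝ E] (x : ι → E) {r : ℕ}
    (hE : 1 ≤ finrank ℝ E)
    (hr : (r - 1) * finrank ℝ E * (finrank ℝ E + 1) < Fintype.card ι) :
    ∃ p, ∃ S : ℕ → Finset ι, (∀ i < r, (S i).card ≤ finrank ℝ E + 1 ∧
      p ∈ convexHull ℝ (x '' S i)) ∧ ∀ i < r, ∀ j < i, Disjoint (S i) (S j) := by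
  obtain ⟨p, hp⟩ := exists_forall_mem_convexHull_image_compl x hr
  set n := finrank ℝ E with hn
  suffices H : ∀ k ≤ r, ∃ S : ℕ → Finset ι, (∀ i < k, (S i).card ≤ n + 1 ∧
      p ∈ convexHull ℝ (x '' S i) ∧
      ∀ u : E →ₗ[ℝ] ℝ, u ≠ 0 → ((S i).filter fun j => u (x j) ≤ u p).card ≤ n) ∧
      ∀ i < k, ∀ j < i, Disjoint (S i) (S j) by
    obtain ⟨S, hS, hd⟩ := H r le_rfl
    exact ⟨p, S, fun i hi => ⟨(hS i hi).1, (hS i hi).2.1⟩, hd⟩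
  intro k
  induction k with
  | zero => exact fun _ => ⟨fun _ => ∅, by simp, by simp⟩
  | succ k ih =>
    intro hk
    obtain ⟨S, hS, hd⟩ := ih (by omega)
    set U : Finset ι := (Finset.range k).biUnion S with hU
    have hkr : k ≤ r - 1 := by omega
    have hmem : p ∈ convexHull ℝ (x '' (U : Set ι)ᶜ) := by
      by_contra hnot
      obtain ⟨u, s, hus, hsu⟩ := geometric_hahn_banach_point_closed (convex_convexHull ℝ _)
        (((Set.toFinite (U : Set ι)ᶜ).image x).isClosed_convexHull ℝ) hnot
      have hlt : ∀ j ∉ U, u p < u (x j) := fun j hj =>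
        hus.trans (hsu _ (subset_convexHull ℝ _ ⟨j, hj, rfl⟩))
      have hUcard : U.card < Fintype.card ι := by
        refine lt_of_le_of_lt (Finset.card_biUnion_le_card_mul _ _ (n + 1) fun i hi =>
          (hS i (Finset.mem_range.1 hi)).1) (lt_of_le_of_lt ?_ hr)
        rw [Finset.card_range]
        exact Nat.mul_le_mul_right _ (hkr.trans (Nat.le_mul_of_pos_right _ hE))
      obtain ⟨j₀, hj₀⟩ : ∃ j, j ∉ U := by
        by_contra! h
        rw [Finset.eq_univ_iff_forall.2 h, Finset.card_univ] at hUcard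
        exact hUcard.false
      have hu0 : (u : E →ₗ[ℝ] ℝ) ≠ 0 := fun h0 => by
        have h1 : ∀ y, u y = 0 := fun y => LinearMap.congr_fun h0 y
        simpa [h1] using hlt j₀ hj₀
      have hTcard : (U.filter fun j => u (x j) ≤ u p).card ≤ (r - 1) * n := by
        rw [hU, Finset.filter_biUnion]
        refine (Finset.card_biUnion_le_card_mul _ _ n fun i hi =>
          (hS i (Finset.mem_range.1 hi)).2.2 u hu0).trans ?_
        rw [Finset.card_range]
        exact Nat.mul_le_mul_right _ hkr
      have hconv : Convex ℝ {y | u p < u y} := convex_halfSpace_gt (u : E →ₗ[ℝ] ℝ).isLinear _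
      refine lt_irrefl (u p) (convexHull_min ?_ hconv (hp _ hTcard))
      rintro _ ⟨j, hj, rfl⟩
      by_cases hjU : j ∈ U
      · simpa [hjU] using hj
      · exact hlt j hjU
    obtain ⟨S', hS'U, hS'p, hS'c, hS'u⟩ := exists_finset_mem_convexHull_card_filter_le x hmem
    have hS'd : ∀ i < k, Disjoint S' (S i) := fun i hi => by
      refine Finset.disjoint_left.2 fun j hj hji => hS'U hj ?_
      exact Finset.mem_biUnion.2 ⟨i, Finset.mem_range.2 hi, hji⟩
    refine ⟨Function.update S k S', fun i hi => ?_, fun i hi j hj => ?_⟩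
    · rcases Nat.lt_succ_iff_lt_or_eq.1 hi with hi | rfl
      · rw [Function.update_of_ne hi.ne]
        exact hS i hi
      · rw [Function.update_self]
        exact ⟨hS'c, hS'p, hS'u⟩
    · rcases Nat.lt_succ_iff_lt_or_eq.1 hi with hi | rfl
      · rw [Function.update_of_ne hi.ne, Function.update_of_ne (hj.trans hi).ne]
        exact hd i hi j hj
      · rw [Function.update_self, Function.update_of_ne hj.ne]
        exact hS'd j hj

/-- Disjoint sets of size at most `a` extend to a partition into parts of size exactly `a`. -/
theorem exists_fiber_card_eq_of_disjoint {a b : ℕ} {S : ℕ → Finset (Fin (a * b))}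
    (hcard : ∀ i < b, (S i).card ≤ a) (hd : ∀ i < b, ∀ j < i, Disjoint (S i) (S j)) :
    ∃ f : Fin (a * b) → Fin b, (∀ i, (Finset.univ.filter fun j => f j = i).card = a) ∧
      ∀ i : Fin b, ∀ j ∈ S i, f j = i := by
  have hemb : ∀ i : Fin b, Nonempty (S i ↪ Fin a) := fun i =>
    Function.Embedding.nonempty_of_card_le (by simpa using hcard i i.2)
  let e := fun i => (hemb i).some
  have hpair : ∀ i j : Fin b, ∀ t, t ∈ S i → t ∈ S j → i = j := fun i j t hi hj => by
    rcases lt_trichotomy i j with h | h | h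
    · exact absurd hi (Finset.disjoint_left.1 (hd j j.2 i h) hj)
    · exact h
    · exact absurd hj (Finset.disjoint_left.1 (hd i i.2 j h) hi)
  have hex : ∀ t, ∃ q : Fin b × Fin a, ∀ (i : Fin b) (h : t ∈ S i),
      q = (i, e i ⟨t, h⟩) := fun t => by
    by_cases ht : ∃ i : Fin b, t ∈ S i
    · obtain ⟨i, hi⟩ := ht
      refine ⟨(i, e i ⟨t, hi⟩), fun j hj => ?_⟩
      obtain rfl := hpair i j t hi hj
      rfl
    · exact ⟨(finProdFinEquiv.symm t).swap, fun i hi => absurd ⟨i, hi⟩ ht⟩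
  choose q hq using hex
  have hinj : Set.InjOn q ↑(Finset.univ.filter fun t => ∃ i : Fin b, t ∈ S i) := by
    intro s hs t ht hst
    obtain ⟨i, hi⟩ := (Finset.mem_filter.1 hs).2
    obtain ⟨j, hj⟩ := (Finset.mem_filter.1 ht).2
    rw [hq s i hi, hq t j hj] at hst
    obtain rfl : i = j := congrArg Prod.fst hst
    exact congrArg Subtype.val ((e i).injective (congrArg Prod.snd hst))
  obtain ⟨g, hg⟩ := Finset.exists_equiv_extend_of_card_eq (t := Finset.univ)
    (by simp [mul_comm]) (Finset.subset_univ _) hinj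
  refine ⟨fun t => (g t).1.1, fun i => ?_, fun i t ht => ?_⟩
  · have hbij : (Finset.univ.filter fun t => (g t).1.1 = i).card
        = ({i} ×ˢ (Finset.univ : Finset (Fin a))).card := by
      refine Finset.card_bij (fun t _ => (g t).1) (fun t ht => ?_)
        (fun s _ t _ h => g.injective (Subtype.ext h)) fun y hy => ?_
      · exact Finset.mem_product.2 ⟨by simpa using ht, Finset.mem_univ _⟩
      · exact ⟨g.symm ⟨y, Finset.mem_univ y⟩, by simpa using (Finset.mem_product.1 hy).1, by simp⟩
    simpa using hbij
  · simp only
    rw [hg t (by simpa using ⟨i, ht⟩), hq t i ht]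

theorem volume_image_toLpLin_add {d : ℕ} (M : Matrix (Fin d) (Fin d) ℝ)
    (c : EuclideanSpace ℝ (Fin d)) (s : Set (EuclideanSpace ℝ (Fin d))) :
    volume ((fun y => Matrix.toLpLin 2 2 M y + c) '' s) = ENNReal.ofReal |M.det| * volume s := by
  rw [← LinearMap.det_toLpLin 2 M, ← Measure.addHaar_image_linearMap,
    ← Set.image_image (fun y => y + c), Set.image_add_right, measure_preimage_add_right]

theorem isEllipsoid_image_toLpLin_add {d : ℕ} {M : Matrix (Fin d) (Fin d) ℝ} (hM : M.det ≠ 0)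
    (c : EuclideanSpace ℝ (Fin d)) :
    IsEllipsoid ((fun y => Matrix.toLpLin 2 2 M y + c) '' Metric.closedBall 0 1) := by
  have hdet : LinearMap.det (Matrix.toLpLin 2 2 M) ≠ 0 := by rwa [LinearMap.det_toLpLin]
  refine ⟨(LinearMap.equivOfDetNeZero _ hdet).toAffineEquiv.trans (AffineEquiv.constVAdd ℝ _ c), ?_⟩
  refine Set.image_congr fun y _ => ?_
  simp [LinearMap.equivOfDetNeZero, add_comm]

/-- An invertible matrix is the product of a lower triangular matrix with positive diagonal and
an isometry. -/
theorem exists_isLowerTriangular_toLpLin {d : ℕ}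
    (T : EuclideanSpace ℝ (Fin d) ≃ₗ[ℝ] EuclideanSpace ℝ (Fin d)) :
    ∃ (M : Matrix (Fin d) (Fin d) ℝ)
      (Q : EuclideanSpace ℝ (Fin d) ≃ₗᵢ[ℝ] EuclideanSpace ℝ (Fin d)),
      M.IsLowerTriangular ∧ (∀ i, 0 < M i i) ∧ ∀ y, T y = Matrix.toLpLin 2 2 M (Q y) := by
  let f : Fin d → EuclideanSpace ℝ (Fin d) := fun i =>
    LinearMap.adjoint (T : EuclideanSpace ℝ (Fin d) →ₗ[ℝ] EuclideanSpace ℝ (Fin d))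
      (EuclideanSpace.single i 1)
  have hf : ∀ i y, inner ℝ (f i) y = T y i := fun i y => by
    simp [f, LinearMap.adjoint_inner_left, EuclideanSpace.inner_single_left]
  let e := InnerProductSpace.gramSchmidtOrthonormalBasis (𝕜 := ℝ) (finrank_euclideanSpace) f
  let σ : Fin d → ℝ := fun j => if 0 ≤ inner ℝ (f j) (e j) then 1 else -1
  have hσ : ∀ j, σ j * σ j = 1 := fun j => by
    by_cases h : 0 ≤ inner ℝ (f j) (e j) <;> simp [σ, h]
  let Q : EuclideanSpace ℝ (Fin d) ≃ₗᵢ[ℝ] EuclideanSpace ℝ (Fin d) :=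
    e.repr.trans (LinearIsometryEquiv.piLpCongrRight 2 fun j =>
      if 0 ≤ inner ℝ (f j) (e j) then LinearIsometryEquiv.refl ℝ ℝ else LinearIsometryEquiv.neg ℝ)
  have hQ : ∀ y j, Q y j = σ j * inner ℝ (e j) y := fun y j => by
    by_cases h : 0 ≤ inner ℝ (f j) (e j) <;>
      simp [Q, σ, h, OrthonormalBasis.repr_apply_apply]
  let M : Matrix (Fin d) (Fin d) ℝ := Matrix.of fun i j => inner ℝ (f i) (e j) * σ j
  have hT : ∀ y, T y = Matrix.toLpLin 2 2 M (Q y) := fun y => by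
    ext i
    rw [← hf, ← e.sum_inner_mul_inner]
    simp only [Matrix.toLpLin_apply, Matrix.mulVec, dotProduct, M, Matrix.of_apply, hQ]
    refine Finset.sum_congr rfl fun j _ => ?_
    linear_combination (-(inner ℝ (f i) (e j) * inner ℝ (e j) y)) * hσ j
  have hlow : M.IsLowerTriangular := fun i j hij => by
    have : inner ℝ (f i) (e j) = 0 := by
      rw [real_inner_comm]
      exact InnerProductSpace.gramSchmidtOrthonormalBasis_inv_triangular _ f hij
    simp [M, this]
  have hdet : M.det ≠ 0 := by
    rw [← LinearMap.det_toLpLin 2 M]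
    have : Matrix.toLpLin 2 2 M = (Q.toLinearEquiv.symm.trans T : _ ≃ₗ[ℝ] _) := by
      ext1 y
      simp [hT]
    rw [this]
    exact (LinearEquiv.isUnit_det' _).ne_zero
  rw [Matrix.det_of_isLowerTriangular M hlow, Finset.prod_ne_zero_iff] at hdet
  refine ⟨M, Q, hlow, fun i => lt_of_le_of_ne ?_ (hdet i (Finset.mem_univ i)).symm, hT⟩
  by_cases h : 0 ≤ inner ℝ (f i) (e i)
  · simp [M, σ, h]
  · simp [M, σ, h, (not_le.1 h).le]

/-- Every ellipsoid is the image of the unit ball under an affine map with lower triangular linear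
part with positive diagonal. -/
theorem IsEllipsoid.exists_isLowerTriangular {d : ℕ} {E : Set (EuclideanSpace ℝ (Fin d))}
    (hE : IsEllipsoid E) :
    ∃ (M : Matrix (Fin d) (Fin d) ℝ) (c : EuclideanSpace ℝ (Fin d)),
      M.IsLowerTriangular ∧ (∀ i, 0 < M i i) ∧
        E = (fun y => Matrix.toLpLin 2 2 M y + c) '' Metric.closedBall 0 1 := by
  obtain ⟨L, rfl⟩ := hE
  obtain ⟨M, Q, hlow, hpos, hM⟩ := exists_isLowerTriangular_toLpLin L.linear
  refine ⟨M, L 0, hlow, hpos, ?_⟩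
  have hL : ∀ y, L y = Matrix.toLpLin 2 2 M (Q y) + L 0 := fun y => by
    rw [← hM]
    simpa using L.map_vadd 0 y
  have hQ : Q '' Metric.closedBall 0 1 = Metric.closedBall 0 1 := by
    simp
  rw [Set.image_congr fun y _ => hL y]
  nth_rw 2 [← hQ]
  rw [Set.image_image]

/-- The geometric mean is quasiconcave on the positive orthant. -/
theorem convex_setOf_pos_le_prod {κ : Type*} [Fintype κ] (D : ℝ) (hD : 0 < D) :
    Convex ℝ {v : κ → ℝ | (∀ k, 0 < v k) ∧ D ≤ ∏ k, v k} := by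
  rintro v ⟨hv, hvD⟩ w ⟨hw, hwD⟩ s t hs ht hst
  refine ⟨fun k => ?_, ?_⟩
  · have := (convex_Ioi (0 : ℝ)) (hv k) (hw k) hs ht hst
    simpa using this
  · calc D = D ^ s * D ^ t := by rw [← Real.rpow_add hD, hst, Real.rpow_one]
      _ ≤ (∏ k, v k) ^ s * (∏ k, w k) ^ t := by
        have := Finset.prod_pos fun k (_ : k ∈ Finset.univ) => hv k
        gcongr
      _ = ∏ k, v k ^ s * w k ^ t := by
        rw [Finset.prod_mul_distrib, Real.finsetProd_rpow _ _ fun k _ => (hv k).le,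
          Real.finsetProd_rpow _ _ fun k _ => (hw k).le]
      _ ≤ ∏ k, (s • v + t • w) k := by
        refine Finset.prod_le_prod (fun k _ => ?_) fun k _ => ?_
        · exact mul_nonneg (Real.rpow_nonneg (hv k).le _) (Real.rpow_nonneg (hw k).le _)
        · exact Real.geom_mean_le_arith_mean2_weighted hs ht (hv k).le (hw k).le hst

/-- Indices of the coordinates of a pair (lower triangular matrix, vector). -/
abbrev LowerTriangularIndex (d : ℕ) : Type := (Σ i : Fin d, Fin (i + 1)) ⊕ Fin d

theorem card_lowerTriangularIndex (d : ℕ) :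
    Fintype.card (LowerTriangularIndex d) = d * (d + 3) / 2 := by
  have h : ∀ n : ℕ, (∑ i : Fin n, ((i : ℕ) + 1) + n) * 2 = n * (n + 3) := fun n => by
    induction n with
    | zero => simp
    | succ n ih =>
      rw [Fin.sum_univ_castSucc]
      simp only [Fin.val_castSucc, Fin.val_last]
      linarith
  simp only [Fintype.card_sum, Fintype.card_sigma, Fintype.card_fin]
  exact (Nat.div_eq_of_eq_mul_left two_pos (h d).symm).symm

/-- The lower triangular matrix with given entries. -/
def lowerTriangularMatrix (d : ℕ) :
    (LowerTriangularIndex d → ℝ) →ₗ[ℝ] Matrix (Fin d) (Fin d) ℝ where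
  toFun v := Matrix.of fun i k =>
    if h : k ≤ i then v (Sum.inl ⟨i, ⟨k, Nat.lt_succ_of_le h⟩⟩) else 0
  map_add' v w := by
    ext i k
    by_cases h : k ≤ i <;> simp [h]
  map_smul' t v := by
    ext i k
    by_cases h : k ≤ i <;> simp [h]

theorem isLowerTriangular_lowerTriangularMatrix {d : ℕ} (v : LowerTriangularIndex d → ℝ) :
    (lowerTriangularMatrix d v).IsLowerTriangular := fun i k hik => by
  have : i < k := hik
  simp only [lowerTriangularMatrix, LinearMap.coe_mk, AddHom.coe_mk, Matrix.of_apply]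
  rw [dif_neg this.not_ge]

/-- The vector with given coordinates. -/
def translationVector (d : ℕ) :
    (LowerTriangularIndex d → ℝ) →ₗ[ℝ] EuclideanSpace ℝ (Fin d) where
  toFun v := WithLp.toLp 2 fun i => v (Sum.inr i)
  map_add' _ _ := rfl
  map_smul' _ _ := rfl

theorem exists_lowerTriangularMatrix_eq {d : ℕ} {M : Matrix (Fin d) (Fin d) ℝ}
    (hM : M.IsLowerTriangular) (c : EuclideanSpace ℝ (Fin d)) :
    ∃ v, lowerTriangularMatrix d v = M ∧ translationVector d v = c := by
  refine ⟨Sum.elim (fun q => M q.1 (q.2.castLE q.1.2)) c, ?_, rfl⟩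
  ext i k
  by_cases h : k ≤ i
  · simp [lowerTriangularMatrix, h]
  · have hik : i < k := not_le.1 h
    simp [lowerTriangularMatrix, h, hM hik]

/-- If `v` is a convex combination of parameters of affine images of the unit ball, the affine image
of the unit ball with parameter `v` lies in the convex hull of these images. -/
theorem image_subset_convexHull_iUnion {d : ℕ} {ι : Type*} (x : ι → LowerTriangularIndex d → ℝ)
    {A : Set ι} {v : LowerTriangularIndex d → ℝ} (hv : v ∈ convexHull ℝ (x '' A)) :
    (fun y => Matrix.toLpLin 2 2 (lowerTriangularMatrix d v) y + translationVector d v) ''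
        Metric.closedBall 0 1 ⊆
      convexHull ℝ (⋃ j ∈ A, (fun y => Matrix.toLpLin 2 2 (lowerTriangularMatrix d (x j)) y +
        translationVector d (x j)) '' Metric.closedBall 0 1) := by
  rintro _ ⟨y, hy, rfl⟩
  let φ : (LowerTriangularIndex d → ℝ) →ₗ[ℝ] EuclideanSpace ℝ (Fin d) :=
    LinearMap.applyₗ y ∘ₗ (Matrix.toLpLin 2 2).toLinearMap ∘ₗ lowerTriangularMatrix d +
      translationVector d
  refine convexHull_min (t := φ ⁻¹' _) ?_ ((convex_convexHull ℝ _).linear_preimage φ) hv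
  rintro _ ⟨j, hj, rfl⟩
  exact subset_convexHull ℝ _ (Set.mem_biUnion hj ⟨y, hy, rfl⟩)

theorem det_lowerTriangularMatrix {d : ℕ} (v : LowerTriangularIndex d → ℝ) :
    (lowerTriangularMatrix d v).det = ∏ i, lowerTriangularMatrix d v i i :=
  Matrix.det_of_isLowerTriangular _ (isLowerTriangular_lowerTriangularMatrix v)

theorem exists_isEllipsoid_volume_eq_one_subset {d : ℕ} (hd : 1 ≤ d)
    {M : Matrix (Fin d) (Fin d) ℝ} (c : EuclideanSpace ℝ (Fin d)) {D : ℝ} (hD : 0 < D)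
    (hvol : ENNReal.ofReal D * volume (Metric.closedBall (0 : EuclideanSpace ℝ (Fin d)) 1) = 1)
    (hM : D ≤ M.det) :
    ∃ E, IsEllipsoid E ∧ volume E = 1 ∧
      E ⊆ (fun y => Matrix.toLpLin 2 2 M y + c) '' Metric.closedBall 0 1 := by
  have hMpos : 0 < M.det := hD.trans_le hM
  have hq : 0 < D / M.det := div_pos hD hMpos
  set s : ℝ := (D / M.det) ^ (d : ℝ)⁻¹ with hs
  have hs0 : 0 < s := Real.rpow_pos_of_pos hq _
  have hs1 : s ≤ 1 := Real.rpow_le_one hq.le ((div_le_one hMpos).2 hM) (by positivity)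
  have hdet : (s • M).det = D := by
    rw [Matrix.det_smul, Fintype.card_fin, hs, Real.rpow_inv_natCast_pow hq.le (by omega),
      div_mul_cancel₀ _ hMpos.ne']
  refine ⟨_, isEllipsoid_image_toLpLin_add (hdet ▸ hD.ne') c, ?_, ?_⟩
  · rw [volume_image_toLpLin_add, hdet, abs_of_pos hD, hvol]
  · rintro _ ⟨y, hy, rfl⟩
    refine ⟨s • y, ?_, by simp⟩
    rw [mem_closedBall_zero_iff] at hy ⊢
    rw [norm_smul, Real.norm_of_nonneg hs0.le]
    exact mul_le_one₀ hs1 (norm_nonneg y) hy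

/-- The possible determinant of an affine map taking the unit ball to a set of volume one. -/
theorem exists_pos_ofReal_mul_volume_closedBall (d : ℕ) :
    ∃ D : ℝ, 0 < D ∧
      ENNReal.ofReal D * volume (Metric.closedBall (0 : EuclideanSpace ℝ (Fin d)) 1) = 1 := by
  have h0 : volume (Metric.closedBall (0 : EuclideanSpace ℝ (Fin d)) 1) ≠ 0 :=
    (Metric.measure_closedBall_pos volume _ one_pos).ne'
  have h1 : volume (Metric.closedBall (0 : EuclideanSpace ℝ (Fin d)) 1) ≠ ⊤ :=
    measure_closedBall_lt_top.ne
  refine ⟨(volume (Metric.closedBall (0 : EuclideanSpace ℝ (Fin d)) 1))⁻¹.toReal,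
    ENNReal.toReal_pos (ENNReal.inv_ne_zero.2 h1) (ENNReal.inv_ne_top.2 h0), ?_⟩
  rw [ENNReal.ofReal_toReal (ENNReal.inv_ne_top.2 h0), ENNReal.inv_mul_cancel h0 h1]

theorem convex_setOf_lowerTriangularMatrix {d : ℕ} {D : ℝ} (hD : 0 < D) :
    Convex ℝ {v | (∀ i, 0 < lowerTriangularMatrix d v i i) ∧
      D ≤ (lowerTriangularMatrix d v).det} := by
  simp only [det_lowerTriangularMatrix]
  exact (convex_setOf_pos_le_prod D hD).linear_preimage
    (Matrix.diagLinearMap (Fin d) ℝ ℝ ∘ₗ lowerTriangularMatrix d)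

/-- Quantitative Tverberg Theorem with equal parts. -/
theorem quantitative_tverberg_equal_parts
    (d : ℕ) (hd : 1 ≤ d) (a b : ℕ)
    (ha : a = (d * (d + 3) / 2 - 1) * (d * (d + 3) / 2 + 1) + 1)
    (hb : b = d * (d + 3) / 2)
    (Es : Fin (a * b) → Set (EuclideanSpace ℝ (Fin d)))
    (hEs : ∀ j, IsEllipsoid (Es j) ∧ volume (Es j) = 1) :
    ∃ f : Fin (a * b) → Fin b,
      (∀ i : Fin b, (Finset.univ.filter (fun j => f j = i)).card = a) ∧
      ∃ E, IsEllipsoid E ∧ volume E = 1 ∧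
        E ⊆ ⋂ i : Fin b, convexHull ℝ (⋃ j ∈ {j : Fin (a * b) | f j = i}, Es j) := by
  classical
  obtain ⟨D, hD, hDvol⟩ := exists_pos_ofReal_mul_volume_closedBall d
  have hx : ∀ j, ∃ v, (∀ i, 0 < lowerTriangularMatrix d v i i) ∧
      D ≤ (lowerTriangularMatrix d v).det ∧
      Es j = (fun y => Matrix.toLpLin 2 2 (lowerTriangularMatrix d v) y + translationVector d v) ''
        Metric.closedBall 0 1 := fun j => by
    obtain ⟨M, c, hlow, hpos, hE⟩ := IsEllipsoid.exists_isLowerTriangular (hEs j).1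
    obtain ⟨v, rfl, rfl⟩ := exists_lowerTriangularMatrix_eq hlow c
    refine ⟨v, hpos, ?_, hE⟩
    have hdet : 0 < (lowerTriangularMatrix d v).det := by
      rw [det_lowerTriangularMatrix]
      exact Finset.prod_pos fun i _ => hpos i
    have hvol := (hEs j).2
    rw [hE, volume_image_toLpLin_add, abs_of_pos hdet, ← hDvol] at hvol
    have h0 := (Metric.measure_closedBall_pos volume (0 : EuclideanSpace ℝ (Fin d)) one_pos).ne'
    have h1 : volume (Metric.closedBall (0 : EuclideanSpace ℝ (Fin d)) 1) ≠ ⊤ :=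
      measure_closedBall_lt_top.ne
    rw [ENNReal.mul_left_inj h0 h1, ENNReal.ofReal_eq_ofReal_iff hdet.le hD.le] at hvol
    exact hvol.ge
  choose x hxpos hxdet hxE using hx
  have hfin : finrank ℝ (LowerTriangularIndex d → ℝ) = b := by
    rw [Module.finrank_fintype_fun_eq_card, card_lowerTriangularIndex, hb]
  have hb2 : 2 ≤ b := by
    rw [hb, Nat.le_div_iff_mul_le two_pos]
    nlinarith
  rw [← hb] at ha
  obtain ⟨r, rfl⟩ : ∃ r, b = r + 1 := ⟨b - 1, by omega⟩
  rw [Nat.add_sub_cancel] at ha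
  obtain ⟨p, S, hS, hSd⟩ := exists_disjoint_mem_convexHull x (r := r + 1) (by omega) (by
    rw [hfin, Fintype.card_fin, Nat.add_sub_cancel, ha]
    nlinarith)
  rw [hfin] at hS
  obtain ⟨f, hfcard, hfS⟩ := exists_fiber_card_eq_of_disjoint
    (fun i hi => (hS i hi).1.trans (by rw [ha]; nlinarith)) hSd
  have hp : D ≤ (lowerTriangularMatrix d p).det := by
    refine (convexHull_min ?_ (convex_setOf_lowerTriangularMatrix hD) (hS 0 (by omega)).2).2
    rintro _ ⟨j, -, rfl⟩
    exact ⟨hxpos j, hxdet j⟩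
  obtain ⟨E, hE, hEvol, hEsub⟩ :=
    exists_isEllipsoid_volume_eq_one_subset hd (translationVector d p) hD hDvol hp
  refine ⟨f, hfcard, E, hE, hEvol, hEsub.trans (Set.subset_iInter fun i => ?_)⟩
  refine (image_subset_convexHull_iUnion x (hS i i.2).2).trans (convexHull_mono ?_)
  simp only [← hxE]
  exact Set.biUnion_subset_biUnion_left fun j hj => hfS i j hj
end

section
/- Existence of quantitative weak ε-nets: For every dimension d ≥ 1 there exists a function f : (0,1] → ℝ with the following property. For any ε ∈ (0,1], if 𝒞 is a finite family of convex bodies in ℝ^d, ℰ is a finite family of ellipsoids in ℝ^d each of volume one, and w : ℰ → [0,1] is a weight function with ∑_{E ∈ ℰ} w(E) = 1 and ∑_{E ∈ ℰ, E ⊆ C} w(E) ≥ ε for every C ∈ 𝒞, then there is a finite family S of ellipsoids of volume one with |S| ≤ f(ε) such that each C ∈ 𝒞 contains a member of S. -/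
open MeasureTheory

/-- The linear endomorphisms whose matrix in the standard basis is lower triangular with positive
diagonal of product at least `v`. -/
def positiveLowerTriangular (d : ℕ) (v : ℝ) :
    Set (EuclideanSpace ℝ (Fin d) →ₗ[ℝ] EuclideanSpace ℝ (Fin d)) :=
  {M | (∀ i j, i < j → M (EuclideanSpace.single j 1) i = 0) ∧
    (∀ i, 0 < M (EuclideanSpace.single i 1) i) ∧ v ≤ ∏ i, M (EuclideanSpace.single i 1) i}

theorem convex_positiveLowerTriangular (d : ℕ) {v : ℝ} (hv : 0 < v) :
    Convex ℝ (positiveLowerTriangular d v) := by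
  rintro M ⟨hM0, hM, hMv⟩ M' ⟨hM0', hM', hMv'⟩ a b ha hb hab
  refine ⟨fun i j hij => by simp [hM0 i j hij, hM0' i j hij], fun i => ?_, ?_⟩
  · exact convex_Ioi (0 : ℝ) (hM i) (hM' i) ha hb hab
  · calc v = v ^ a * v ^ b := by rw [← Real.rpow_add hv, hab, Real.rpow_one]
      _ ≤ (∏ i, M (EuclideanSpace.single i 1) i) ^ a *
          (∏ i, M' (EuclideanSpace.single i 1) i) ^ b := by
          have hprod : 0 ≤ ∏ i, M (EuclideanSpace.single i 1) i := hv.le.trans hMv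
          gcongr
      _ = ∏ i, M (EuclideanSpace.single i 1) i ^ a * M' (EuclideanSpace.single i 1) i ^ b := by
          rw [Finset.prod_mul_distrib, Real.finsetProd_rpow _ _ fun i _ => (hM i).le,
            Real.finsetProd_rpow _ _ fun i _ => (hM' i).le]
      _ ≤ _ := by
          refine Finset.prod_le_prod (fun i _ => mul_nonneg
            (Real.rpow_nonneg (hM i).le _) (Real.rpow_nonneg (hM' i).le _)) fun i _ => ?_
          simpa using Real.geom_mean_le_arith_mean2_weighted ha hb (hM i).le (hM' i).le hab

theorem det_eq_prod_of_lowerTriangular {d : ℕ}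
    {M : EuclideanSpace ℝ (Fin d) →ₗ[ℝ] EuclideanSpace ℝ (Fin d)}
    (hM : ∀ i j, i < j → M (EuclideanSpace.single j 1) i = 0) :
    LinearMap.det M = ∏ i, M (EuclideanSpace.single i 1) i := by
  rw [← LinearMap.det_toMatrix (EuclideanSpace.basisFun (Fin d) ℝ).toBasis,
    Matrix.det_of_isLowerTriangular]
  · simp [LinearMap.toMatrix_apply]
  · intro i j hij
    simpa [LinearMap.toMatrix_apply] using hM i j hij

/-- Every ellipsoid is a translate of the image of the unit ball under a lower triangular map with
positive diagonal. -/
theorem exists_lowerTriangular_image_closedBall {d : ℕ}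
    (f : EuclideanSpace ℝ (Fin d) ≃ₗ[ℝ] EuclideanSpace ℝ (Fin d)) :
    ∃ M : EuclideanSpace ℝ (Fin d) →ₗ[ℝ] EuclideanSpace ℝ (Fin d),
      (∀ i j, i < j → M (EuclideanSpace.single j 1) i = 0) ∧
      (∀ i, 0 < M (EuclideanSpace.single i 1) i) ∧
      M '' Metric.closedBall 0 1 = f '' Metric.closedBall 0 1 := by
  let g := LinearMap.adjoint (f : EuclideanSpace ℝ (Fin d) →ₗ[ℝ] EuclideanSpace ℝ (Fin d))
  let r : Fin d → EuclideanSpace ℝ (Fin d) := fun i => g (EuclideanSpace.single i 1)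
  have hg : Function.Injective g := by
    rw [injective_iff_map_eq_zero]
    intro y hy
    refine ext_inner_right ℝ fun z => ?_
    rw [← f.apply_symm_apply z, inner_zero_left]
    have := LinearMap.adjoint_inner_left
      (f : EuclideanSpace ℝ (Fin d) →ₗ[ℝ] EuclideanSpace ℝ (Fin d)) (f.symm z) y
    rw [show LinearMap.adjoint
      (f : EuclideanSpace ℝ (Fin d) →ₗ[ℝ] EuclideanSpace ℝ (Fin d)) y = 0 from hy] at this
    simpa using this.symm
  have hr : LinearIndependent ℝ r := by
    have h := (EuclideanSpace.basisFun (Fin d) ℝ).toBasis.linearIndependent.map' g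
      (LinearMap.ker_eq_bot.2 hg)
    have hcomp : g ∘ (EuclideanSpace.basisFun (Fin d) ℝ).toBasis = r := by
      ext i
      simp [r]
    exact hcomp ▸ h
  have hcard : Module.finrank ℝ (EuclideanSpace ℝ (Fin d)) = Fintype.card (Fin d) := by simp
  let q := InnerProductSpace.gramSchmidtOrthonormalBasis hcard r
  let U := q.repr.symm
  have hentry : ∀ i j, f (U (EuclideanSpace.single j 1)) i = inner ℝ (q j) (r i) := by
    intro i j
    rw [real_inner_comm]
    change _ = inner ℝ (LinearMap.adjoint _ _) _
    rw [LinearMap.adjoint_inner_left]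
    simp [U, EuclideanSpace.inner_single_left]
  refine ⟨(f : EuclideanSpace ℝ (Fin d) →ₗ[ℝ] EuclideanSpace ℝ (Fin d)) ∘ₗ
    (U.toLinearEquiv : EuclideanSpace ℝ (Fin d) →ₗ[ℝ] EuclideanSpace ℝ (Fin d)), ?_, ?_, ?_⟩
  · intro i j hij
    exact (hentry i j).trans
      (InnerProductSpace.gramSchmidtOrthonormalBasis_inv_triangular hcard r hij)
  · intro i
    refine lt_of_lt_of_eq ?_ (hentry i i).symm
    have hne : InnerProductSpace.gramSchmidt ℝ r i ≠ 0 :=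
      InnerProductSpace.gramSchmidt_ne_zero i hr
    have hnorm : InnerProductSpace.gramSchmidtNormed ℝ r i ≠ 0 := by
      rw [← norm_ne_zero_iff, InnerProductSpace.gramSchmidtNormed_unit_length i hr]
      exact one_ne_zero
    have hself : inner ℝ (InnerProductSpace.gramSchmidt ℝ r i) (r i) =
        ‖InnerProductSpace.gramSchmidt ℝ r i‖ ^ 2 := by
      conv_lhs => rw [InnerProductSpace.gramSchmidt_def'' ℝ r i]
      rw [inner_add_right, inner_sum, Finset.sum_eq_zero, add_zero, real_inner_self_eq_norm_sq]
      intro j hj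
      rw [inner_smul_right,
        InnerProductSpace.gramSchmidt_orthogonal ℝ r (Finset.mem_Iio.1 hj).ne', mul_zero]
    simp only [q]
    rw [InnerProductSpace.gramSchmidtOrthonormalBasis_apply hcard hnorm,
      InnerProductSpace.gramSchmidtNormed, real_inner_smul_left, hself]
    have := norm_pos_iff.2 hne
    simp only [RCLike.ofReal_real_eq_id, id]
    positivity
  · have hU : U '' Metric.closedBall 0 1 = Metric.closedBall 0 1 := by simp
    rw [LinearMap.coe_comp, Set.image_comp]
    exact congrArg (f '' ·) hU

theorem IsEllipsoid.exists_lowerTriangular {d : ℕ} {E : Set (EuclideanSpace ℝ (Fin d))}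
    (hE : IsEllipsoid E) (hvol : volume E = 1) :
    ∃ (M : EuclideanSpace ℝ (Fin d) →ₗ[ℝ] EuclideanSpace ℝ (Fin d))
      (c : EuclideanSpace ℝ (Fin d)),
      M ∈ positiveLowerTriangular d
        (volume (Metric.closedBall (0 : EuclideanSpace ℝ (Fin d)) 1)).toReal⁻¹ ∧
      E = (fun u => M u + c) '' Metric.closedBall 0 1 := by
  obtain ⟨L, rfl⟩ := hE
  obtain ⟨M, hM0, hM, himage⟩ := exists_lowerTriangular_image_closedBall L.linear
  have hL : L '' Metric.closedBall 0 1 = (fun u => M u + L 0) '' Metric.closedBall 0 1 := by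
    calc L '' Metric.closedBall 0 1
        = (· + L 0) '' (L.linear '' Metric.closedBall 0 1) := by
          rw [Set.image_image]
          refine Set.image_congr fun u _ => ?_
          simpa using L.map_vadd 0 u
      _ = _ := by rw [← himage, Set.image_image]
  refine ⟨M, L 0, ⟨hM0, hM, ?_⟩, hL⟩
  rw [hL, ← Set.image_image (· + L 0) M, Set.image_add_right, measure_preimage_add_right,
    Measure.addHaar_image_linearMap, det_eq_prod_of_lowerTriangular hM0,
    abs_of_pos (Finset.prod_pos fun i _ => hM i)] at hvol
  have h := congrArg ENNReal.toReal hvol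
  rw [ENNReal.toReal_mul, ENNReal.toReal_ofReal (Finset.prod_pos fun i _ => hM i).le,
    ENNReal.toReal_one] at h
  exact (eq_inv_of_mul_eq_one_left h).ge

/-- An ellipsoid of volume at least one contains a concentric ellipsoid of volume one. -/
theorem exists_isEllipsoid_subset {d : ℕ} (hd : 1 ≤ d)
    {M : EuclideanSpace ℝ (Fin d) →ₗ[ℝ] EuclideanSpace ℝ (Fin d)}
    (hM : M ∈ positiveLowerTriangular d
      (volume (Metric.closedBall (0 : EuclideanSpace ℝ (Fin d)) 1)).toReal⁻¹)
    (c : EuclideanSpace ℝ (Fin d)) :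
    ∃ E, IsEllipsoid E ∧ volume E = 1 ∧ E ⊆ (fun u => M u + c) '' Metric.closedBall 0 1 := by
  obtain ⟨hM0, hMpos, hMv⟩ := hM
  set V := volume (Metric.closedBall (0 : EuclideanSpace ℝ (Fin d)) 1) with hV
  have hV0 : 0 < V.toReal := ENNReal.toReal_pos
    (Metric.measure_closedBall_pos volume _ one_pos).ne' measure_closedBall_lt_top.ne
  rw [← det_eq_prod_of_lowerTriangular hM0] at hMv
  have hdet : 0 < LinearMap.det M := (inv_pos.2 hV0).trans_le hMv
  obtain ⟨s, hs0, hs1, hs⟩ :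
      ∃ s : ℝ, 0 < s ∧ s ≤ 1 ∧ s ^ d = V.toReal⁻¹ / LinearMap.det M := by
    have h0 : 0 < V.toReal⁻¹ / LinearMap.det M := by positivity
    exact ⟨(V.toReal⁻¹ / LinearMap.det M) ^ (d : ℝ)⁻¹, by positivity,
      Real.rpow_le_one h0.le ((div_le_one hdet).2 hMv) (by positivity),
      Real.rpow_inv_natCast_pow h0.le (by omega)⟩
  have hdets : LinearMap.det (s • M) = V.toReal⁻¹ := by
    rw [LinearMap.det_smul, finrank_euclideanSpace_fin, hs, div_mul_cancel₀ _ hdet.ne']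
  have hne : LinearMap.det (s • M) ≠ 0 := by
    rw [hdets]
    positivity
  let L := ((s • M).equivOfDetNeZero hne).toAffineEquiv.trans (AffineEquiv.vaddConst ℝ c)
  have hL : ∀ u, L u = (s • M) u + c := fun u => rfl
  refine ⟨L '' Metric.closedBall 0 1, ⟨L, rfl⟩, ?_, ?_⟩
  · rw [Set.image_congr fun u _ => hL u, ← Set.image_image (· + c) (s • M), Set.image_add_right,
      measure_preimage_add_right, Measure.addHaar_image_linearMap, hdets,
      abs_of_pos (inv_pos.2 hV0), ENNReal.ofReal_inv_of_pos hV0,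
      ENNReal.ofReal_toReal measure_closedBall_lt_top.ne]
    exact ENNReal.inv_mul_cancel (Metric.measure_closedBall_pos volume _ one_pos).ne'
      measure_closedBall_lt_top.ne
  · rintro _ ⟨u, hu, rfl⟩
    refine ⟨s • u, ?_, by simp [hL]⟩
    rw [mem_closedBall_zero_iff] at hu ⊢
    rw [norm_smul, Real.norm_of_nonneg hs0.le]
    exact mul_le_one₀ hs1 (norm_nonneg u) hu

/-- A weighted quantile. -/
theorem exists_weighted_quantile {ι : Type*} (s : Finset ι) (a w : ι → ℝ) {c : ℝ} (hc : 0 < c)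
    (hs : c ≤ ∑ i ∈ s, w i) :
    ∃ q : ℝ, ∑ i ∈ s with a i < q, w i < c ∧ c ≤ ∑ i ∈ s with a i ≤ q, w i := by
  classical
  let T := (s.image a).filter fun t => c ≤ ∑ i ∈ s with a i ≤ t, w i
  have hne : s.Nonempty := by
    rw [Finset.nonempty_iff_ne_empty]
    rintro rfl
    simp at hs
    linarith
  have hT : T.Nonempty := by
    obtain ⟨j, hj, hmax⟩ := s.exists_max_image a hne
    refine ⟨a j, Finset.mem_filter.2 ⟨Finset.mem_image_of_mem a hj, ?_⟩⟩
    rwa [Finset.filter_true_of_mem hmax]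
  refine ⟨T.min' hT, ?_, (Finset.mem_filter.1 (T.min'_mem hT)).2⟩
  by_contra! h
  have hne' : (s.filter fun i => a i < T.min' hT).Nonempty := by
    rw [Finset.nonempty_iff_ne_empty]
    intro h0
    rw [h0] at h
    simp at h
    linarith
  obtain ⟨j, hj, hmax⟩ := Finset.exists_max_image _ a hne'
  rw [Finset.mem_filter] at hj
  have hmem : a j ∈ T := by
    refine Finset.mem_filter.2 ⟨Finset.mem_image_of_mem a hj.1, h.trans_eq ?_⟩
    congr 1
    ext i
    simp only [Finset.mem_filter]
    exact ⟨fun hi => ⟨hi.1, hmax i (Finset.mem_filter.2 hi)⟩,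
      fun hi => ⟨hi.1, hi.2.trans_lt hj.2⟩⟩
  exact absurd (T.min'_le _ hmem) (not_le.2 hj.2)

/-- Boundedly many thresholds split every set of weight at least `3 * δ` into two parts of
weight at least `δ` each. -/
theorem exists_splitting_thresholds {ι : Type*} [Fintype ι] (a w : ι → ℝ) (hw : ∀ i, 0 ≤ w i)
    {δ : ℝ} (hδ : 0 < δ) {K : ℕ} (hK : ∑ i, w i < (K + 1) * δ) :
    ∃ T : Finset ℝ, T.card ≤ K + 1 ∧ ∀ A : Finset ι, 3 * δ ≤ ∑ i ∈ A, w i →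
      ∃ t ∈ T, δ ≤ ∑ i ∈ A with a i ≤ t, w i ∧ δ ≤ ∑ i ∈ A with t ≤ a i, w i := by
  classical
  have hq : ∀ k : ℕ, ∃ q : ℝ, (k + 1) * δ ≤ ∑ i, w i →
      ∑ i with a i < q, w i < (k + 1) * δ ∧ (k + 1) * δ ≤ ∑ i with a i ≤ q, w i := by
    intro k
    by_cases h : (k + 1) * δ ≤ ∑ i, w i
    · obtain ⟨q, hq⟩ := exists_weighted_quantile Finset.univ a w (by positivity) h
      exact ⟨q, fun _ => hq⟩
    · exact ⟨0, fun h' => absurd h' h⟩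
  choose q hq using hq
  have sub : ∀ {s t : Finset ι}, s ⊆ t → ∑ i ∈ s, w i ≤ ∑ i ∈ t, w i := fun h =>
    Finset.sum_le_sum_of_subset_of_nonneg h fun i _ _ => hw i
  have split : ∀ (s : Finset ι) (t : ℝ),
      ∑ i ∈ s with a i ≤ t, w i + ∑ i ∈ s with t < a i, w i = ∑ i ∈ s, w i := by
    intro s t
    rw [← Finset.sum_filter_add_sum_filter_not s (fun i => a i ≤ t)]
    simp only [not_le]
  have split' : ∀ (s : Finset ι) (t : ℝ),
      ∑ i ∈ s with a i < t, w i + ∑ i ∈ s with t ≤ a i, w i = ∑ i ∈ s, w i := by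
    intro s t
    rw [← Finset.sum_filter_add_sum_filter_not s (fun i => a i < t)]
    simp only [not_lt]
  refine ⟨(Finset.range (K + 1)).image q,
    Finset.card_image_le.trans (Finset.card_range _).le, fun A hA => ?_⟩
  -- otherwise every quantile has little of `A` below it
  by_contra! hcon
  have key : ∀ k : ℕ, (k + 1) * δ ≤ ∑ i, w i → ∑ i ∈ A with a i ≤ q k, w i < δ := by
    intro k
    induction k with
    | zero =>
      intro hk
      by_contra! hlow
      have hlt : 0 < K + 1 := by omega
      have h1 := hcon (q 0) (Finset.mem_image_of_mem q (Finset.mem_range.2 hlt)) hlow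
      have h2 := split' A (q 0)
      have h3 : ∑ i ∈ A with a i < q 0, w i ≤ ∑ i with a i < q 0, w i :=
        sub (Finset.filter_subset_filter _ (Finset.subset_univ _))
      have h4 := (hq 0 hk).1
      push_cast at h4
      linarith
    | succ k ih =>
      intro hk
      push_cast at hk
      have hk' : (k + 1) * δ ≤ ∑ i, w i := by nlinarith
      have ihk := ih hk'
      by_contra! hlow
      have hlt : k + 1 < K + 1 := by
        by_contra! hge
        have : ((K : ℝ) + 1) ≤ k + 1 := by exact_mod_cast hge
        nlinarith
      have h1 := hcon (q (k + 1)) (Finset.mem_image_of_mem q (Finset.mem_range.2 hlt)) hlow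
      have h2 := split' A (q (k + 1))
      have h4 := (hq (k + 1) (by push_cast; exact hk)).1
      push_cast at h4
      have h5 := (hq k hk').2
      have h6 : ∑ i ∈ A with a i < q (k + 1), w i ≤
          ∑ i ∈ A with a i ≤ q k, w i + ∑ i with q k < a i ∧ a i < q (k + 1), w i := by
        rw [← split (A.filter fun i => a i < q (k + 1)) (q k)]
        refine add_le_add (sub ?_) (sub ?_) <;> intro i <;> simp +contextual
      have h7 : ∑ i with a i ≤ q k, w i + ∑ i with q k < a i ∧ a i < q (k + 1), w i ≤
          max (∑ i with a i < q (k + 1), w i) (∑ i with a i ≤ q k, w i) := by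
        rcases le_or_gt (q (k + 1)) (q k) with hle | hgt
        · refine le_max_of_le_right (le_of_eq ?_)
          rw [add_eq_left]
          refine Finset.sum_eq_zero fun i hi => ?_
          rw [Finset.mem_filter] at hi
          linarith [hi.2.1, hi.2.2]
        · refine le_max_of_le_left ?_
          rw [← split (Finset.univ.filter fun i => a i < q (k + 1)) (q k)]
          refine add_le_add (sub ?_) (sub ?_) <;> intro i <;> simp +contextual
          intro hi
          linarith
      rcases le_max_iff.1 h7 with h | h <;> linarith
  -- the last quantile leaves little weight above it
  rcases lt_or_ge (∑ i, w i) δ with h | h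
  · have := sub (Finset.subset_univ A)
    linarith
  · obtain ⟨k, hk1, hk2⟩ : ∃ k : ℕ, (k + 1) * δ ≤ ∑ i, w i ∧ ∑ i, w i < (k + 2) * δ := by
      have hone : 1 ≤ (∑ i, w i) / δ := (one_le_div hδ).2 h
      have hfl : 1 ≤ ⌊(∑ i, w i) / δ⌋₊ := Nat.le_floor (by exact_mod_cast hone)
      obtain ⟨k, hk⟩ := Nat.exists_eq_add_of_le hfl
      have h1 := Nat.floor_le (zero_le_one.trans hone)
      have h2 := Nat.lt_floor_add_one ((∑ i, w i) / δ)
      rw [hk] at h1 h2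
      push_cast at h1 h2
      rw [le_div_iff₀ hδ] at h1
      rw [div_lt_iff₀ hδ] at h2
      exact ⟨k, by linarith, by linarith⟩
    have h1 := key k hk1
    have h2 := split A (q k)
    have h3 := split Finset.univ (q k)
    have h4 := (hq k hk1).2
    have h5 : ∑ i ∈ A with q k < a i, w i ≤ ∑ i with q k < a i, w i :=
      sub (Finset.filter_subset_filter _ (Finset.subset_univ _))
    linarith

/-- Coordinate version of `exists_weak_net`, by induction on the dimension. -/
theorem exists_weak_net_fin (n : ℕ) : ∀ ε : ℝ, 0 < ε → ∃ N : ℕ,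
    ∀ (ι : Type) [Fintype ι] (x : ι → Fin n → ℝ) (w : ι → ℝ), (∀ i, 0 ≤ w i) → ∑ i, w i ≤ 1 →
      ∃ S : Finset (Fin n → ℝ), S.card ≤ N ∧ ∀ (C : Set (Fin n → ℝ)), Convex ℝ C →
        ∀ A : Finset ι, (∀ i ∈ A, x i ∈ C) → ε ≤ ∑ i ∈ A, w i → ∃ p ∈ S, p ∈ C := by
  classical
  induction n with
  | zero =>
    intro ε hε
    refine ⟨1, fun ι _ x w hw hsum => ⟨{0}, by simp, fun C hC A hA hεA => ?_⟩⟩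
    obtain ⟨i, hi, -⟩ := Finset.exists_ne_zero_of_sum_ne_zero (hε.trans_le hεA).ne'
    exact ⟨0, by simp, by rw [Subsingleton.elim 0 (x i)]; exact hA i hi⟩
  | succ n ih =>
    intro ε hε
    have hδ : 0 < ε / 3 := by positivity
    set δ := ε / 3 with hδ_def
    obtain ⟨K, hK⟩ := exists_nat_gt (1 / δ)
    rw [div_lt_iff₀ hδ] at hK
    obtain ⟨N, hN⟩ := ih (δ * δ) (by positivity)
    refine ⟨(K + 1) * N, fun ι _ x w hw hsum => ?_⟩
    obtain ⟨T, hTcard, hT⟩ := exists_splitting_thresholds (fun i => x i 0) w hw hδ (K := K)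
      (by nlinarith)
    -- where the segment from `x i` to `x j` crosses the hyperplane at height `t`
    have hz : ∀ (t : ℝ) (p : ι × ι), ∃ z : Fin n → ℝ, x p.1 0 ≤ t → t ≤ x p.2 0 →
        (Fin.cons t z : Fin (n + 1) → ℝ) ∈ segment ℝ (x p.1) (x p.2) := by
      rintro t ⟨i, j⟩
      by_cases h : x i 0 ≤ t ∧ t ≤ x j 0
      · have ht : t ∈ segment ℝ (x i 0) (x j 0) := by
          rw [segment_eq_Icc (h.1.trans h.2)]; exact h
        obtain ⟨a, b, ha, hb, hab, rfl⟩ := ht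
        refine ⟨Fin.tail (a • x i + b • x j), fun _ _ => ⟨a, b, ha, hb, hab, ?_⟩⟩
        exact (Fin.cons_self_tail (a • x i + b • x j)).symm
      · exact ⟨0, fun h1 h2 => absurd ⟨h1, h2⟩ h⟩
    choose z hz using hz
    have hnet : ∀ t : ℝ, ∃ S : Finset (Fin n → ℝ), S.card ≤ N ∧ ∀ (C : Set (Fin n → ℝ)),
        Convex ℝ C → ∀ A : Finset (ι × ι), (∀ i ∈ A, z t i ∈ C) →
          δ * δ ≤ ∑ i ∈ A, w i.1 * w i.2 → ∃ p ∈ S, p ∈ C := by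
      intro t
      refine hN (ι × ι) (z t) (fun p => w p.1 * w p.2) (fun p => mul_nonneg (hw _) (hw _)) ?_
      rw [Fintype.sum_prod_type' (fun i j => w i * w j), ← Finset.sum_mul_sum]
      exact mul_le_one₀ hsum (Finset.sum_nonneg fun i _ => hw i) hsum
    choose S hScard hS using hnet
    refine ⟨T.biUnion fun t => (S t).image fun y => (Fin.cons t y : Fin (n + 1) → ℝ), ?_, ?_⟩
    · refine (Finset.card_biUnion_le_card_mul _ _ N fun t _ =>
        Finset.card_image_le.trans (hScard t)).trans ?_
      gcongr
    · intro C hC A hA hεA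
      obtain ⟨t, ht, h1, h2⟩ := hT A (by rw [hδ_def]; linarith)
      suffices h : ∃ p ∈ S t, p ∈ {y | (Fin.cons t y : Fin (n + 1) → ℝ) ∈ C} by
        obtain ⟨p, hp, hpC⟩ := h
        exact ⟨_, Finset.mem_biUnion.2 ⟨t, ht, Finset.mem_image_of_mem _ hp⟩, hpC⟩
      refine hS t _ ?_ ((A.filter fun i => x i 0 ≤ t) ×ˢ (A.filter fun i => t ≤ x i 0)) ?_ ?_
      · intro y hy y' hy' a b ha hb hab
        have := hC hy hy' ha hb hab
        simp only [Set.mem_ofPred_eq]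
        convert this using 1
        ext i
        refine Fin.cases ?_ (fun i => ?_) i
        · simp [← add_mul, hab]
        · simp
      · rintro ⟨i, j⟩ hij
        simp only [Finset.mem_product, Finset.mem_filter] at hij
        exact hC.segment_subset (hA i hij.1.1) (hA j hij.2.1) (hz t (i, j) hij.1.2 hij.2.2)
      · rw [Finset.sum_product' _ _ (fun i j => w i * w j), ← Finset.sum_mul_sum]
        exact mul_le_mul h1 h2 hδ.le (hδ.le.trans h1)

/-- Existence of weak `ε`-nets for weighted finite point sets in a finite-dimensional space. -/
theorem exists_weak_net (V : Type*) [AddCommGroup V] [Module ℝ V] [Module.Finite ℝ V]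
    {ε : ℝ} (hε : 0 < ε) : ∃ N : ℕ,
    ∀ (ι : Type) [Fintype ι] (x : ι → V) (w : ι → ℝ), (∀ i, 0 ≤ w i) → ∑ i, w i ≤ 1 →
      ∃ S : Finset V, S.card ≤ N ∧ ∀ C : Set V, Convex ℝ C →
        ∀ A : Finset ι, (∀ i ∈ A, x i ∈ C) → ε ≤ ∑ i ∈ A, w i → ∃ p ∈ S, p ∈ C := by
  classical
  let e := (Module.finBasis ℝ V).equivFun
  obtain ⟨N, hN⟩ := exists_weak_net_fin (Module.finrank ℝ V) ε hε
  refine ⟨N, fun ι _ x w hw hsum => ?_⟩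
  obtain ⟨S, hS, h⟩ := hN ι (fun i => e (x i)) w hw hsum
  refine ⟨S.image e.symm, Finset.card_image_le.trans hS, fun C hC A hA hεA => ?_⟩
  obtain ⟨p, hp, hpC⟩ := h (e.symm ⁻¹' C) (hC.linear_preimage e.symm.toLinearMap) A
    (fun i hi => by simpa using hA i hi) hεA
  exact ⟨_, Finset.mem_image_of_mem _ hp, hpC⟩

open scoped Classical in
/-- Existence of quantitative weak ε-nets. -/
theorem quantitative_weak_epsilon_net (d : ℕ) (hd : 1 ≤ d) :
    ∃ f : ℝ → ℝ,
      ∀ ε : ℝ, ε ∈ Set.Ioc (0 : ℝ) 1 →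
        ∀ n : ℕ, ∀ C : Fin n → Set (EuclideanSpace ℝ (Fin d)),
          (∀ i, Convex ℝ (C i) ∧ IsCompact (C i) ∧ (interior (C i)).Nonempty) →
          ∀ m : ℕ, ∀ Es : Fin m → Set (EuclideanSpace ℝ (Fin d)),
            (∀ j, IsEllipsoid (Es j) ∧ volume (Es j) = 1) →
            ∀ w : Fin m → ℝ,
              (∀ j, w j ∈ Set.Icc (0 : ℝ) 1) →
              (∑ j, w j) = 1 →
              (∀ i, ε ≤ ∑ j ∈ Finset.univ.filter (fun j => Es j ⊆ C i), w j) →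
              ∃ S : Finset (Set (EuclideanSpace ℝ (Fin d))),
                (S.card : ℝ) ≤ f ε ∧
                (∀ E ∈ S, IsEllipsoid E ∧ volume E = 1) ∧
                ∀ i, ∃ E ∈ S, E ⊆ C i := by
  choose! N hN using fun (ε : ℝ) (hε : 0 < ε) =>
    exists_weak_net ((EuclideanSpace ℝ (Fin d) →ₗ[ℝ] EuclideanSpace ℝ (Fin d)) ×
      EuclideanSpace ℝ (Fin d)) hε
  refine ⟨fun ε => N ε, fun ε hε n C hC m Es hEs w hw hsum hεC => ?_⟩
  choose M c hM hE using fun j => (hEs j).1.exists_lowerTriangular (hEs j).2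
  obtain ⟨S, hScard, hS⟩ := hN ε hε.1 (Fin m) (fun j => (M j, c j)) w (fun j => (hw j).1) hsum.le
  set v := (volume (Metric.closedBall (0 : EuclideanSpace ℝ (Fin d)) 1)).toReal⁻¹ with hv_def
  have hv : 0 < v := inv_pos.2 <| ENNReal.toReal_pos
    (Metric.measure_closedBall_pos volume _ one_pos).ne' measure_closedBall_lt_top.ne
  choose! F hF using fun (p : (EuclideanSpace ℝ (Fin d) →ₗ[ℝ] EuclideanSpace ℝ (Fin d)) ×
      EuclideanSpace ℝ (Fin d)) (hp : p.1 ∈ positiveLowerTriangular d v) =>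
    exists_isEllipsoid_subset hd hp p.2
  refine ⟨(S.filter fun p => p.1 ∈ positiveLowerTriangular d v).image F, ?_, ?_, fun i => ?_⟩
  · exact Nat.cast_le.2
      (Finset.card_image_le.trans ((Finset.card_filter_le _ _).trans hScard))
  · intro E hE
    obtain ⟨p, hp, rfl⟩ := Finset.mem_image.1 hE
    have := hF p (Finset.mem_filter.1 hp).2
    exact ⟨this.1, this.2.1⟩
  · suffices h : ∃ p ∈ S, p ∈ {p : (EuclideanSpace ℝ (Fin d) →ₗ[ℝ] EuclideanSpace ℝ (Fin d)) ×
        EuclideanSpace ℝ (Fin d) | p.1 ∈ positiveLowerTriangular d v ∧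
          ∀ u ∈ Metric.closedBall 0 1, p.1 u + p.2 ∈ C i} by
      obtain ⟨p, hpS, hpM, hpC⟩ := h
      refine ⟨F p, Finset.mem_image_of_mem F (Finset.mem_filter.2 ⟨hpS, hpM⟩), ?_⟩
      refine (hF p hpM).2.2.trans ?_
      rintro _ ⟨u, hu, rfl⟩
      exact hpC u hu
    refine hS _ ?_ (Finset.univ.filter fun j => Es j ⊆ C i) ?_ (hεC i)
    · intro p hp p' hp' a b ha hb hab
      refine ⟨convex_positiveLowerTriangular d hv hp.1 hp'.1 ha hb hab, fun u hu => ?_⟩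
      convert (hC i).1 (hp.2 u hu) (hp'.2 u hu) ha hb hab using 1
      simp only [Prod.fst_add, Prod.snd_add, Prod.smul_fst, Prod.smul_snd, LinearMap.add_apply,
        LinearMap.smul_apply, smul_add]
      abel
    · intro j hj
      refine ⟨hM j, fun u hu => (Finset.mem_filter.1 hj).2 ?_⟩
      rw [hE j]
      exact ⟨u, hu, rfl⟩
end

section
/- Boundedness of the quantitative fractional v-transversal number: There is a universal constant c > 0 such that for every dimension d ≥ 1 and every integer p ≥ 3d+1 there exists h = h(p,d) > 0 with the following property. Let 𝒞 be a finite family of convex sets in ℝ^d, each containing an ellipsoid of volume one, and assume that among any p members of 𝒞 there exist 3d+1 whose intersection contains an ellipsoid of volume one. Then, with v = c^(d²) · d^(−5d²/2 + d), there exists a nonnegative function φ on the set of volume-v ellipsoids in ℝ^d, attaining nonzero values on only finitely many ellipsoids, such that for every C ∈ 𝒞 the sum of φ(E) over all volume-v ellipsoids E contained in C is at least 1, and the total sum of φ over all volume-v ellipsoids is less than h. -/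
open MeasureTheory

theorem isCompact_convexHull_biUnion {ι V : Type*} [AddCommGroup V] [Module ℝ V]
    [TopologicalSpace V] [ContinuousAdd V] [ContinuousSMul ℝ V] (s : Finset ι) (A : ι → Set V)
    (hconv : ∀ i ∈ s, Convex ℝ (A i)) (hcomp : ∀ i ∈ s, IsCompact (A i)) :
    IsCompact (convexHull ℝ (⋃ i ∈ s, A i)) := by
  classical
  induction s using Finset.induction_on with
  | empty => simp
  | insert a s ha ih =>
    have ih' := ih (fun i hi => hconv i (by simp [hi])) (fun i hi => hcomp i (by simp [hi]))
    rw [Finset.set_biUnion_insert]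
    have hc := hcomp a (by simp)
    have hv := hconv a (by simp)
    rcases (A a).eq_empty_or_nonempty with h | h
    · rwa [h, Set.empty_union]
    rcases (⋃ i ∈ s, A i).eq_empty_or_nonempty with h' | h'
    · rwa [h', Set.union_empty, hv.convexHull_eq]
    rw [convexHull_union h h', hv.convexHull_eq]
    have him : convexJoin ℝ (A a) (convexHull ℝ (⋃ i ∈ s, A i)) =
        (fun q : ℝ × V × V => (1 - q.1) • q.2.1 + q.1 • q.2.2) ''
          (Set.Icc (0 : ℝ) 1 ×ˢ (A a ×ˢ convexHull ℝ (⋃ i ∈ s, A i))) := by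
      ext x
      simp only [mem_convexJoin, segment_eq_image, Set.mem_image, Set.mem_prod, Prod.exists]
      constructor
      · rintro ⟨u, hu, w, hw, t, ht, rfl⟩
        exact ⟨t, u, w, ⟨ht, hu, hw⟩, rfl⟩
      · rintro ⟨t, u, w, ⟨ht, hu, hw⟩, rfl⟩
        exact ⟨u, hu, w, hw, t, ht, rfl⟩
    rw [him]
    exact (isCompact_Icc.prod (hc.prod ih')).image (by fun_prop)

/-- A weighted combination of more than `finrank` vectors can be rewritten without one of them,
without increasing the total weight. -/
theorem exists_erase_conic_combination {V : Type*} [AddCommGroup V] [Module ℝ V]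
    [FiniteDimensional ℝ V] [DecidableEq V] (t : Finset V) (ht : Module.finrank ℝ V < t.card)
    (w : V → ℝ) (hw : ∀ x ∈ t, 0 ≤ w x) :
    ∃ a ∈ t, ∃ w' : V → ℝ, (∀ x ∈ t.erase a, 0 ≤ w' x) ∧
      ∑ x ∈ t.erase a, w' x ≤ ∑ x ∈ t, w x ∧
      ∑ x ∈ t.erase a, w' x • x = ∑ x ∈ t, w x • x := by
  obtain ⟨g, hg0, hgs, hgpos⟩ : ∃ g : V → ℝ, ∑ x ∈ t, g x • x = 0 ∧ 0 ≤ ∑ x ∈ t, g x ∧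
      ∃ x ∈ t, 0 < g x := by
    obtain ⟨f, hf0, hf⟩ := Module.exists_nontrivial_relation_of_finrank_lt_card ht
    have key : ∀ g : V → ℝ, (∃ x ∈ t, g x ≠ 0) → 0 ≤ ∑ x ∈ t, g x → ∃ x ∈ t, 0 < g x := by
      rintro g ⟨x, hx, hgx⟩ h0
      by_contra! hcon
      have hlt := Finset.sum_lt_sum hcon ⟨x, hx, lt_of_le_of_ne (hcon x hx) hgx⟩
      simp at hlt
      linarith
    rcases le_total 0 (∑ x ∈ t, f x) with h | h
    · exact ⟨f, hf0, h, key f hf h⟩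
    · have h' : 0 ≤ ∑ x ∈ t, -f x := by simpa using h
      refine ⟨fun x => -f x, by simp [hf0], h', key _ ?_ h'⟩
      simpa using hf
  obtain ⟨a, ha, hmin⟩ := (t.filter (fun x => 0 < g x)).exists_min_image (fun x => w x / g x)
    (by obtain ⟨x, hx, hx'⟩ := hgpos; exact ⟨x, by simp [hx, hx']⟩)
  simp only [Finset.mem_filter] at ha hmin
  have hs0 : 0 ≤ w a / g a := div_nonneg (hw a ha.1) ha.2.le
  have hza : w a - w a / g a * g a = 0 := by
    rw [div_mul_cancel₀ _ ha.2.ne', sub_self]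
  refine ⟨a, ha.1, fun x => w x - w a / g a * g x, fun x hx => ?_, ?_, ?_⟩
  · have hxt := Finset.mem_of_mem_erase hx
    rcases le_or_gt (g x) 0 with h | h
    · have := mul_nonneg hs0 (neg_nonneg.2 h)
      have := hw x hxt
      simp only
      linarith
    · have := hmin x ⟨hxt, h⟩
      rw [le_div_iff₀ h] at this
      simp only
      linarith
  · rw [Finset.sum_erase t (f := fun x => w x - w a / g a * g x) hza, Finset.sum_sub_distrib,
      ← Finset.mul_sum]
    have := mul_nonneg hs0 hgs
    linarith
  · rw [Finset.sum_erase _ (by simp only [hza, zero_smul])]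
    simp only [sub_smul, mul_smul, Finset.sum_sub_distrib]
    rw [← Finset.smul_sum, hg0, smul_zero, sub_zero]

/-- A point of a convex hull is a subconvex combination of at most `finrank` points. -/
theorem exists_subconvex_combination {V : Type*} [AddCommGroup V] [Module ℝ V]
    [FiniteDimensional ℝ V] {X : Set V} {y : V} (hy : y ∈ convexHull ℝ X) :
    ∃ t : Finset V, ↑t ⊆ X ∧ t.card ≤ Module.finrank ℝ V ∧ ∃ w : V → ℝ, (∀ x ∈ t, 0 ≤ w x) ∧
      ∑ x ∈ t, w x ≤ 1 ∧ ∑ x ∈ t, w x • x = y := by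
  classical
  have main : ∀ (n : ℕ) (t : Finset V), t.card = n → ↑t ⊆ X → ∀ w : V → ℝ, (∀ x ∈ t, 0 ≤ w x) →
      ∑ x ∈ t, w x ≤ 1 → ∑ x ∈ t, w x • x = y →
      ∃ t : Finset V, ↑t ⊆ X ∧ t.card ≤ Module.finrank ℝ V ∧ ∃ w : V → ℝ, (∀ x ∈ t, 0 ≤ w x) ∧
      ∑ x ∈ t, w x ≤ 1 ∧ ∑ x ∈ t, w x • x = y := by
    intro n
    induction n with
    | zero => exact fun t h0 hX w hw h1 h2 => ⟨t, hX, by omega, w, hw, h1, h2⟩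
    | succ n ih =>
      intro t hn hX w hw h1 h2
      rcases le_or_gt t.card (Module.finrank ℝ V) with h | h
      · exact ⟨t, hX, h, w, hw, h1, h2⟩
      obtain ⟨a, ha, w', hw', h1', h2'⟩ := exists_erase_conic_combination t h w hw
      exact ih (t.erase a) (by rw [Finset.card_erase_of_mem ha]; omega)
        (fun x hx => hX (Finset.mem_of_mem_erase hx)) w' hw' (h1'.trans h1) (h2'.trans h2)
  rw [convexHull_eq_union] at hy
  simp only [Set.mem_iUnion] at hy
  obtain ⟨t, htX, -, hyt⟩ := hy
  obtain ⟨w, hw, h1, h2⟩ := Finset.mem_convexHull'.1 hyt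
  exact main _ t rfl htX w hw h1.le h2

/-- In a compact set containing a multiple of each coordinate vector one can choose `d` vectors
such that all others have coefficients in `[-1, 1]` with respect to them. -/
theorem exists_coeff_abs_le_one {d : ℕ} {X : Set (EuclideanSpace ℝ (Fin d))} (hX : IsCompact X)
    {r : ℝ} (hr : 0 < r) (hrX : Metric.closedBall 0 r ⊆ X) :
    ∃ v : Fin d → EuclideanSpace ℝ (Fin d), (∀ i, v i ∈ X) ∧
      ∀ y ∈ X, ∃ a : Fin d → ℝ, (∀ i, |a i| ≤ 1) ∧ y = ∑ i, a i • v i := by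
  classical
  let M : (Fin d → EuclideanSpace ℝ (Fin d)) → Matrix (Fin d) (Fin d) ℝ := fun v =>
    Matrix.of (fun i j => v i j)
  have hcont : Continuous fun v : Fin d → EuclideanSpace ℝ (Fin d) => |(M v).det| := by
    refine (Continuous.matrix_det ?_).abs
    refine continuous_matrix fun i j => ?_
    simp only [M, Matrix.of_apply]
    fun_prop
  have he : ∀ i : Fin d, r • EuclideanSpace.single i (1 : ℝ) ∈ X := fun i => hrX (by
    simp [norm_smul, abs_of_pos hr])
  obtain ⟨v, hv, hmax⟩ := (isCompact_univ_pi fun _ : Fin d => hX).exists_isMaxOn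
    ⟨fun i => r • EuclideanSpace.single i (1 : ℝ), fun i _ => he i⟩ hcont.continuousOn
  have hvX : ∀ i, v i ∈ X := fun i => hv i (Set.mem_univ i)
  have hdet0 : (M v).det ≠ 0 := by
    have h1 := hmax (a := fun i => r • EuclideanSpace.single i (1 : ℝ)) (fun i _ => he i)
    have h2 : M (fun i => r • EuclideanSpace.single i (1 : ℝ)) =
        r • (1 : Matrix (Fin d) (Fin d) ℝ) := by
      ext i j
      simp [M, Matrix.one_apply, eq_comm]
    simp only [Set.mem_ofPred_eq, h2, Matrix.det_smul, Matrix.det_one] at h1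
    intro h
    rw [h] at h1
    simp only [abs_zero, mul_one] at h1
    exact absurd h1 (not_le.2 (abs_pos.2 (by positivity)))
  refine ⟨v, hvX, fun y hy => ?_⟩
  have hunit : IsUnit (M v).det := isUnit_iff_ne_zero.2 hdet0
  let a : Fin d → ℝ := Matrix.vecMul y.ofLp (M v)⁻¹
  have hya : y.ofLp = ∑ k, a k • (M v) k := by
    have : Matrix.vecMul a (M v) = y.ofLp := by
      simp [a, Matrix.vecMul_vecMul, Matrix.nonsing_inv_mul _ hunit]
    rw [← this]
    ext j
    simp [Matrix.vecMul, dotProduct]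
  refine ⟨a, fun i => ?_, ?_⟩
  · have h1 := hmax (a := Function.update v i y) (fun k _ => by
      rcases eq_or_ne k i with rfl | h
      · simpa using hy
      · simpa [h] using hvX k)
    have h2 : M (Function.update v i y) = (M v).updateRow i (∑ k, a k • (M v) k) := by
      rw [← hya]
      ext k j
      rcases eq_or_ne k i with rfl | h
      · simp [M]
      · simp [M, h, Matrix.updateRow_ne]
    simp only [Set.mem_ofPred_eq, h2, Matrix.det_updateRow_sum, smul_eq_mul, abs_mul] at h1
    exact le_of_mul_le_mul_right (by linarith) (abs_pos.2 hdet0)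
  · ext j
    have := congrFun hya j
    simpa [M] using this

/-- A point outside a closed convex set containing the origin is cut off by a polar vector. -/
theorem exists_inner_le_one_of_notMem {V : Type*} [NormedAddCommGroup V] [InnerProductSpace ℝ V]
    [CompleteSpace V] {A : Set V} (hconv : Convex ℝ A) (hcl : IsClosed A) (h0 : (0 : V) ∈ A)
    {z : V} (hz : z ∉ A) :
    ∃ y : V, (∀ x ∈ A, inner ℝ x y ≤ 1) ∧ 1 < inner ℝ z y := by
  obtain ⟨f, u, hf, hu⟩ := geometric_hahn_banach_closed_point hconv hcl hz
  have hu0 : 0 < u := by simpa using hf 0 h0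
  have hin : ∀ x, inner ℝ x (u⁻¹ • (InnerProductSpace.toDual ℝ V).symm f) = u⁻¹ * f x := by
    intro x
    rw [inner_smul_right, real_inner_comm, InnerProductSpace.toDual_symm_apply]
  refine ⟨u⁻¹ • (InnerProductSpace.toDual ℝ V).symm f, fun x hx => ?_, ?_⟩
  · rw [hin, inv_mul_le_iff₀ hu0, mul_one]
    exact (hf x hx).le
  · rw [hin, lt_inv_mul_iff₀ hu0, mul_one]
    exact hu

/-- If the intersection of compact convex sets contains the origin in its interior and is not too
asymmetric about it, then the intersection of some `2 * d` of the sets is contained in a multiple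
of the whole intersection. -/
theorem exists_card_le_iInter_subset_of_zero_mem {d : ℕ} (hd : 1 ≤ d) {ι : Type*} [Fintype ι]
    [Nonempty ι] (A : ι → Set (EuclideanSpace ℝ (Fin d))) (hconv : ∀ i, Convex ℝ (A i))
    (hcomp : ∀ i, IsCompact (A i)) (h0 : (0 : EuclideanSpace ℝ (Fin d)) ∈ interior (⋂ i, A i))
    (hneg : ∀ x ∈ ⋂ i, A i, -((d : ℝ)⁻¹ • x) ∈ ⋂ i, A i) :
    ∃ J : Finset ι, J.card ≤ 2 * d ∧ ∀ ρ : ℝ, 0 ≤ ρ → ρ * (d ^ 2 + 2 * d) ≤ 1 →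
      ∀ x ∈ ⋂ i ∈ J, A i, ρ • x ∈ ⋂ i, A i := by
  classical
  have hd0 : (0 : ℝ) < d := by exact_mod_cast hd
  have h0A : ∀ i, (0 : EuclideanSpace ℝ (Fin d)) ∈ A i :=
    fun i => Set.mem_iInter.1 (interior_subset h0) i
  obtain ⟨ε, hε, hball⟩ := Metric.nhds_basis_closedBall.mem_iff.1 (mem_interior_iff_mem_nhds.1 h0)
  let P : ι → Set (EuclideanSpace ℝ (Fin d)) := fun i => {y | ∀ x ∈ A i, inner ℝ x y ≤ 1}
  have hPeq : ∀ i, P i = ⋂ x ∈ A i, {y | inner ℝ x y ≤ 1} := by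
    intro i; ext y; simp [P]
  have hPconv : ∀ i, Convex ℝ (P i) := by
    intro i y hy z hz a b ha hb hab x hx
    rw [inner_add_right, inner_smul_right, inner_smul_right]
    have h1 := mul_le_mul_of_nonneg_left (hy x hx) ha
    have h2 := mul_le_mul_of_nonneg_left (hz x hx) hb
    linarith
  have hPclosed : ∀ i, IsClosed (P i) := by
    intro i
    rw [hPeq]
    exact isClosed_biInter fun x _ => isClosed_le (by fun_prop) (by fun_prop)
  have hPcomp : ∀ i, IsCompact (P i) := by
    intro i
    refine (isCompact_closedBall (0 : EuclideanSpace ℝ (Fin d)) ε⁻¹).of_isClosed_subset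
      (hPclosed i) fun y hy => ?_
    rw [mem_closedBall_zero_iff]
    rcases eq_or_ne y 0 with rfl | hy0
    · simpa using hε.le
    have hn : 0 < ‖y‖ := norm_pos_iff.2 hy0
    have hmem : (ε / ‖y‖) • y ∈ A i := by
      refine Set.mem_iInter.1 (hball ?_) i
      rw [mem_closedBall_zero_iff, norm_smul, Real.norm_of_nonneg (by positivity),
        div_mul_cancel₀ _ hn.ne']
    have := hy _ hmem
    rw [real_inner_smul_left, real_inner_self_eq_norm_sq] at this
    rw [le_inv_comm₀ hn hε, ← one_div, le_div_iff₀ hn]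
    calc ε * ‖y‖ = ε / ‖y‖ * ‖y‖ ^ 2 := by field_simp
      _ ≤ 1 := this
  have hbip : ∀ i z, (∀ y ∈ P i, inner ℝ z y ≤ 1) → z ∈ A i := by
    intro i z hz
    by_contra hcon
    obtain ⟨y, hy, hy'⟩ := exists_inner_le_one_of_notMem (hconv i) (hcomp i).isClosed (h0A i) hcon
    exact absurd (hz y hy) (not_le.2 hy')
  let X : Set (EuclideanSpace ℝ (Fin d)) := ⋃ i ∈ Finset.univ, P i
  have hX : ∀ y, y ∈ X ↔ ∃ i, y ∈ P i := by simp [X]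
  have hXcomp : IsCompact X := Finset.univ.isCompact_biUnion fun i _ => hPcomp i
  have hXr : ∃ r, 0 < r ∧ Metric.closedBall 0 r ⊆ X := by
    obtain ⟨i⟩ := ‹Nonempty ι›
    obtain ⟨R, hR, hAR⟩ := (hcomp i).isBounded.subset_closedBall_lt 0 0
    refine ⟨R⁻¹, inv_pos.2 hR, fun y hy => (hX y).2 ⟨i, fun x hx => ?_⟩⟩
    have h1 := mem_closedBall_zero_iff.1 (hAR hx)
    have h2 := mem_closedBall_zero_iff.1 hy
    calc inner ℝ x y ≤ ‖x‖ * ‖y‖ := real_inner_le_norm x y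
      _ ≤ R * R⁻¹ := by gcongr
      _ = 1 := mul_inv_cancel₀ hR.ne'
  obtain ⟨r, hr, hrX⟩ := hXr
  have h0X : (0 : EuclideanSpace ℝ (Fin d)) ∈ X := hrX (by simp [hr.le])
  obtain ⟨v, hvX, hv⟩ := exists_coeff_abs_le_one hXcomp hr hrX
  set z := ∑ i, v i with hz
  have hzX : -(((d : ℝ) ^ 2)⁻¹ • z) ∈ convexHull ℝ X := by
    by_contra hcon
    obtain ⟨x, hx, hx'⟩ := exists_inner_le_one_of_notMem (convex_convexHull ℝ X)
      (isCompact_convexHull_biUnion Finset.univ P (fun i _ => hPconv i)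
        (fun i _ => hPcomp i)).isClosed (subset_convexHull ℝ X h0X) hcon
    have hxK : x ∈ ⋂ i, A i := Set.mem_iInter.2 fun i => hbip i x fun y hy => by
      rw [real_inner_comm]
      exact hx y (subset_convexHull ℝ X ((hX y).2 ⟨i, hy⟩))
    have hx2 := hneg x hxK
    have hle : ∀ k, inner ℝ (-((d : ℝ)⁻¹ • x)) (v k) ≤ 1 := by
      intro k
      obtain ⟨i, hi⟩ := (hX _).1 (hvX k)
      exact hi _ (Set.mem_iInter.1 hx2 i)
    have hsum : inner ℝ (-((d : ℝ)⁻¹ • x)) z ≤ d := by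
      rw [hz, inner_sum]
      simpa using Finset.sum_le_sum fun k (_ : k ∈ Finset.univ) => hle k
    have : inner ℝ (-(((d : ℝ) ^ 2)⁻¹ • z)) x = (d : ℝ)⁻¹ * inner ℝ (-((d : ℝ)⁻¹ • x)) z := by
      rw [inner_neg_left, inner_neg_left, real_inner_smul_left, real_inner_smul_left,
        real_inner_comm]
      field_simp
    rw [this] at hx'
    have := mul_le_mul_of_nonneg_left hsum (inv_nonneg.2 hd0.le)
    rw [inv_mul_cancel₀ hd0.ne'] at this
    linarith
  obtain ⟨t, htX, htcard, w, hw0, hw1, hwz⟩ := exists_subconvex_combination hzX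
  rw [finrank_euclideanSpace_fin] at htcard
  choose! idx hidx using fun y (hy : y ∈ X) => (hX y).1 hy
  refine ⟨Finset.univ.image (fun k => idx (v k)) ∪ t.image idx, ?_, ?_⟩
  · calc _ ≤ (Finset.univ.image (fun k => idx (v k))).card + (t.image idx).card :=
          Finset.card_union_le _ _
      _ ≤ (Finset.univ : Finset (Fin d)).card + t.card :=
          add_le_add Finset.card_image_le Finset.card_image_le
      _ ≤ 2 * d := by simp; omega
  intro ρ hρ hρ1 x hx
  have hxJ : ∀ i ∈ Finset.univ.image (fun k => idx (v k)) ∪ t.image idx, x ∈ A i := by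
    simpa only [Set.mem_iInter] using hx
  have hxv : ∀ k, inner ℝ x (v k) ≤ 1 := fun k =>
    hidx _ (hvX k) x (hxJ _ (Finset.mem_union_left _
      (Finset.mem_image_of_mem _ (Finset.mem_univ k))))
  have hxt : ∀ y ∈ t, inner ℝ x y ≤ 1 := fun y hy =>
    hidx _ (htX hy) x (hxJ _ (Finset.mem_union_right _ (Finset.mem_image_of_mem _ hy)))
  have hxz : -((d : ℝ) ^ 2) ≤ ∑ k, inner ℝ x (v k) := by
    have h1 : inner ℝ x (-(((d : ℝ) ^ 2)⁻¹ • z)) ≤ 1 := by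
      rw [← hwz, inner_sum]
      refine le_trans (Finset.sum_le_sum fun y hy => ?_) hw1
      rw [inner_smul_right]
      simpa using mul_le_mul_of_nonneg_left (hxt y hy) (hw0 y hy)
    rw [inner_neg_right, inner_smul_right, ← mul_neg, inv_mul_le_iff₀ (by positivity), mul_one, hz,
      inner_sum] at h1
    linarith
  have habs : ∑ k, |inner ℝ x (v k)| ≤ (d : ℝ) ^ 2 + 2 * d := by
    have : ∀ k ∈ Finset.univ, |inner ℝ x (v k)| ≤ 2 - inner ℝ x (v k) := by
      intro k _
      have := hxv k
      rw [abs_le]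
      constructor <;> linarith
    refine (Finset.sum_le_sum this).trans ?_
    rw [Finset.sum_sub_distrib]
    simp
    linarith
  refine Set.mem_iInter.2 fun i => hbip i _ fun y hy => ?_
  obtain ⟨a, ha, rfl⟩ := hv y ((hX y).2 ⟨i, hy⟩)
  rw [real_inner_smul_left, inner_sum]
  refine le_trans (mul_le_mul_of_nonneg_left ?_ hρ) hρ1
  refine le_trans (Finset.sum_le_sum fun k _ => ?_) habs
  rw [inner_smul_right]
  calc a k * inner ℝ x (v k) ≤ |a k * inner ℝ x (v k)| := le_abs_self _
    _ = |a k| * |inner ℝ x (v k)| := abs_mul _ _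
    _ ≤ 1 * |inner ℝ x (v k)| := by gcongr; exact ha k
    _ = _ := one_mul _

/-- A convex body in `ℝ^d` has an interior point whose Minkowski asymmetry is at most `d`. -/
theorem exists_mem_interior_homothety_mem {d : ℕ} (hd : 1 ≤ d) {K : Set (EuclideanSpace ℝ (Fin d))}
    (hconv : Convex ℝ K) (hcomp : IsCompact K) (hint : (interior K).Nonempty) :
    ∃ o ∈ interior K, ∀ x ∈ K, o - (d : ℝ)⁻¹ • (x - o) ∈ K := by
  classical
  have hd0 : (0 : ℝ) < d := by exact_mod_cast hd
  obtain ⟨q, hq⟩ := hint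
  have hqK := interior_subset hq
  let F : K → Set (EuclideanSpace ℝ (Fin d)) :=
    fun x => (fun y => ((d : ℝ) + 1)⁻¹ • (x.1 + (d : ℝ) • y)) '' K
  have hF : (⋂ x, F x).Nonempty := by
    refine Convex.helly_theorem_compact' (𝕜 := ℝ) (fun x => ?_) (fun x => hcomp.image (by fun_prop))
      fun I hI => ?_
    · rintro _ ⟨y, hy, rfl⟩ _ ⟨y', hy', rfl⟩ a b ha hb hab
      refine ⟨a • y + b • y', hconv hy hy' ha hb hab, ?_⟩
      obtain rfl : b = 1 - a := by linarith
      simp only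
      module
    · rw [finrank_euclideanSpace_fin] at hI
      have hcard : ((I.card : ℝ)) ≤ d + 1 := by exact_mod_cast hI
      refine ⟨((d : ℝ) + 1)⁻¹ • (∑ x ∈ I, x.1 + ((d : ℝ) + 1 - I.card) • q), ?_⟩
      simp only [Set.mem_iInter]
      intro x hx
      refine ⟨(d : ℝ)⁻¹ • (∑ y ∈ I.erase x, y.1 + ((d : ℝ) + 1 - I.card) • q), ?_, ?_⟩
      · have hce : ((I.erase x).card : ℝ) = I.card - 1 := by
          rw [Finset.card_erase_of_mem hx, Nat.cast_pred (Finset.card_pos.2 ⟨x, hx⟩)]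
        have := hconv.sum_mem (t := Finset.insertNone (I.erase x))
          (w := fun o : Option K => o.elim ((d : ℝ)⁻¹ * ((d : ℝ) + 1 - I.card)) fun _ => (d : ℝ)⁻¹)
          (z := fun o : Option K => o.elim q fun y => y.1) ?_ ?_ ?_
        · rw [Finset.sum_insertNone] at this
          simp only [Option.elim] at this
          convert this using 1
          rw [smul_add, Finset.smul_sum, smul_smul, add_comm]
        · rintro (_ | y) _
          · exact mul_nonneg (by positivity) (by linarith)
          · simp [hd0.le]
        · rw [Finset.sum_insertNone]
          simp only [Option.elim, Finset.sum_const, nsmul_eq_mul, hce]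
          field_simp
          ring
        · rintro (_ | y) _
          · exact hqK
          · exact y.2
      · simp only
        rw [smul_smul, mul_inv_cancel₀ hd0.ne', one_smul, ← add_assoc, Finset.add_sum_erase I _ hx]
  obtain ⟨o, ho⟩ := hF
  have hmem : ∀ x ∈ K, o - (d : ℝ)⁻¹ • (x - o) ∈ K := by
    intro x hx
    obtain ⟨y, hy, hyo⟩ := Set.mem_iInter.1 ho ⟨x, hx⟩
    simp only at hyo
    convert hy using 1
    rw [← hyo]
    match_scalars
    · field_simp
      ring
    · field_simp
      ring
  refine ⟨o, ?_, hmem⟩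
  have h := hconv.combo_interior_self_mem_interior hq (hmem q hqK) (a := ((d : ℝ) + 1)⁻¹)
    (b := (d : ℝ) * ((d : ℝ) + 1)⁻¹) (by positivity) (by positivity) (by field_simp; ring)
  convert h using 1
  match_scalars
  · field_simp
    ring
  · field_simp
    ring

/-- Among compact convex sets in `ℝ^d` whose intersection has interior points there are `2 * d` sets
whose intersection is contained in a homothetic copy of the whole intersection. -/
theorem exists_card_le_iInter_subset_homothety {d : ℕ} (hd : 1 ≤ d) {ι : Type*} [Fintype ι]
    [Nonempty ι] (A : ι → Set (EuclideanSpace ℝ (Fin d))) (hconv : ∀ i, Convex ℝ (A i))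
    (hcomp : ∀ i, IsCompact (A i)) (hint : (interior (⋂ i, A i)).Nonempty) :
    ∃ J : Finset ι, J.card ≤ 2 * d ∧ ∃ o : EuclideanSpace ℝ (Fin d),
      ∀ ρ : ℝ, 0 ≤ ρ → ρ * (d ^ 2 + 2 * d) ≤ 1 →
      ∀ x ∈ ⋂ i ∈ J, A i, o + ρ • (x - o) ∈ ⋂ i, A i := by
  have hKcomp : IsCompact (⋂ i, A i) := by
    obtain ⟨i⟩ := ‹Nonempty ι›
    exact (hcomp i).of_isClosed_subset (isClosed_iInter fun i => (hcomp i).isClosed)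
      (Set.iInter_subset _ i)
  obtain ⟨o, ho, hasym⟩ := exists_mem_interior_homothety_mem hd (convex_iInter hconv) hKcomp hint
  let B : ι → Set (EuclideanSpace ℝ (Fin d)) := fun i => (fun x => o + x) ⁻¹' A i
  have hBmem : ∀ x, x ∈ ⋂ i, B i ↔ o + x ∈ ⋂ i, A i := by simp [B]
  have h0 : (0 : EuclideanSpace ℝ (Fin d)) ∈ interior (⋂ i, B i) := by
    have : (⋂ i, B i) = (Homeomorph.addLeft o) ⁻¹' (⋂ i, A i) := by
      ext x
      exact hBmem x
    rw [this, ← Homeomorph.preimage_interior]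
    simpa using ho
  obtain ⟨J, hJ, h⟩ := exists_card_le_iInter_subset_of_zero_mem hd B
    (fun i => (hconv i).translate_preimage_right o)
    (fun i => (Homeomorph.addLeft o).isCompact_preimage.2 (hcomp i)) h0 fun x hx => by
      rw [hBmem] at hx ⊢
      have := hasym _ hx
      rwa [add_sub_cancel_left, sub_eq_add_neg] at this
  refine ⟨J, hJ, o, fun ρ h0 h1 x hx => ?_⟩
  rw [← hBmem]
  refine h ρ h0 h1 _ ?_
  simpa [B] using hx

theorem eq_of_forall_norm_le {V : Type*} [NormedAddCommGroup V] [InnerProductSpace ℝ V] {K : Set V}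
    (hK : Convex ℝ K) {x y : V} (hx : x ∈ K) (hy : y ∈ K) (hxm : ∀ z ∈ K, ‖x‖ ≤ ‖z‖)
    (hym : ∀ z ∈ K, ‖y‖ ≤ ‖z‖) : x = y := by
  have hxy : ‖x‖ = ‖y‖ := (hxm y hy).antisymm (hym x hx)
  have hmid := hxm _ (hK hx hy (a := 1 / 2) (b := 1 / 2) (by norm_num) (by norm_num) (by norm_num))
  rw [← smul_add, norm_smul] at hmid
  norm_num at hmid
  have hpar := parallelogram_law_with_norm ℝ x y
  have h0 : ‖x - y‖ * ‖x - y‖ ≤ 0 := by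
    nlinarith [norm_nonneg x, norm_nonneg (x + y)]
  exact sub_eq_zero.1 (norm_eq_zero.1 (mul_self_eq_zero.1 (h0.antisymm (mul_self_nonneg _))))

/-- A point selection which pierces one of the remaining sets of every intersecting `(d + 1)`-tuple
of closed convex sets in `ℝ^d`. -/
theorem exists_selection_mem_of_iInter_nonempty {d : ℕ} {κ : Type*}
    (D : κ → Set (EuclideanSpace ℝ (Fin d))) (hconv : ∀ k, Convex ℝ (D k))
    (hclosed : ∀ k, IsClosed (D k)) :
    ∃ m : (Fin d → κ) → EuclideanSpace ℝ (Fin d),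
      ∀ u : Fin (d + 1) → κ, (⋂ j, D (u j)).Nonempty → ∃ j, m (u ∘ j.succAbove) ∈ D (u j) := by
  have hmin : ∀ K : Set (EuclideanSpace ℝ (Fin d)), IsClosed K → K.Nonempty →
      ∃ x ∈ K, ∀ y ∈ K, ‖x‖ ≤ ‖y‖ := by
    intro K hK hne
    obtain ⟨x, hx, h⟩ := hK.exists_infDist_eq_dist hne 0
    refine ⟨x, hx, fun y hy => ?_⟩
    have := Metric.infDist_le_dist_of_mem (x := (0 : EuclideanSpace ℝ (Fin d))) hy
    simpa [h] using this
  have hex : ∀ τ : Fin d → κ, ∃ x, (⋂ j, D (τ j)).Nonempty →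
      x ∈ ⋂ j, D (τ j) ∧ ∀ y ∈ ⋂ j, D (τ j), ‖x‖ ≤ ‖y‖ := by
    intro τ
    by_cases h : (⋂ j, D (τ j)).Nonempty
    · obtain ⟨x, hx⟩ := hmin _ (isClosed_iInter fun j => hclosed (τ j)) h
      exact ⟨x, fun _ => hx⟩
    · exact ⟨0, fun h' => absurd h' h⟩
  choose m hm using hex
  refine ⟨m, fun u hu => ?_⟩
  obtain ⟨x, hx, hxmin⟩ := hmin _ (isClosed_iInter fun j => hclosed (u j)) hu
  by_contra! hcon
  let F : Option (Fin (d + 1)) → Set (EuclideanSpace ℝ (Fin d)) := fun o =>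
    o.elim (Metric.ball 0 ‖x‖) fun j => D (u j)
  have hF : (⋂ o ∈ (Finset.univ : Finset (Option (Fin (d + 1)))), F o).Nonempty := by
    refine Convex.helly_theorem (𝕜 := ℝ) (by simp) ?_ ?_
    · rintro (_ | j) _
      · exact convex_ball _ _
      · exact hconv _
    · intro I _ hI
      obtain ⟨a, ha⟩ : ∃ a, a ∉ I := by
        by_contra! h
        have := Finset.eq_univ_iff_forall.2 h
        simp [this] at hI
      rcases a with _ | j
      · refine ⟨x, Set.mem_iInter₂.2 ?_⟩
        rintro (_ | i) hi
        · exact absurd hi ha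
        · exact Set.mem_iInter.1 hx i
      · by_contra hemp
        have hle : ∀ y ∈ ⋂ i, D (u (j.succAbove i)), ‖x‖ ≤ ‖y‖ := by
          intro y hy
          by_contra! hlt
          refine hemp ⟨y, Set.mem_iInter₂.2 ?_⟩
          rintro (_ | i) hi
          · simpa [F] using hlt
          · have hij : i ≠ j := by
              rintro rfl
              exact ha hi
            obtain ⟨k, rfl⟩ := Fin.exists_succAbove_eq hij
            exact Set.mem_iInter.1 hy k
        have hx' : x ∈ ⋂ i, D (u (j.succAbove i)) :=
          Set.mem_iInter.2 fun i => Set.mem_iInter.1 hx _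
        obtain ⟨hm1, hm2⟩ := hm (u ∘ j.succAbove) ⟨x, hx'⟩
        refine hcon j ?_
        rw [← eq_of_forall_norm_le (convex_iInter fun i => hconv _) hx' hm1 hle hm2]
        exact Set.mem_iInter.1 hx j
  obtain ⟨y, hy⟩ := hF
  have hy1 : ‖y‖ < ‖x‖ := by
    simpa [F] using Set.mem_iInter₂.1 hy none (Finset.mem_univ _)
  exact hy1.not_ge (hxmin y (Set.mem_iInter.2 fun j =>
    Set.mem_iInter₂.1 hy (some j) (Finset.mem_univ _)))

/-- A finite minimax principle: if every convex combination of the columns of a real matrix has an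
entry at least `β`, then some convex combination of its rows has all entries at least `β`. -/
theorem exists_mem_stdSimplex_forall_le_sum {Θ K : Type*} [Fintype Θ] [Fintype K] [Nonempty K]
    (a : Θ → K → ℝ) (β : ℝ) (h : ∀ w ∈ stdSimplex ℝ K, ∃ θ, β ≤ ∑ k, w k * a θ k) :
    ∃ μ ∈ stdSimplex ℝ Θ, ∀ k, β ≤ ∑ θ, μ θ * a θ k := by
  classical
  by_contra! hcon
  let T : (Θ → ℝ) →ₗ[ℝ] (K → ℝ) := Fintype.linearCombination ℝ a
  have hT : ∀ μ k, T μ k = ∑ θ, μ θ * a θ k := by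
    intro μ k
    simp [T, Fintype.linearCombination_apply]
  have hTc : Continuous T := T.continuous_of_finiteDimensional
  have hdisj : Disjoint (T '' stdSimplex ℝ Θ) {x : K → ℝ | ∀ k, β ≤ x k} := by
    rw [Set.disjoint_left]
    rintro _ ⟨μ, hμ, rfl⟩ hx
    obtain ⟨k, hk⟩ := hcon μ hμ
    have := hx k
    rw [hT] at this
    linarith
  have hQ : {x : K → ℝ | ∀ k, β ≤ x k} = Set.Ici fun _ => β := by
    ext x
    rfl
  rw [hQ] at hdisj
  obtain ⟨f, u, v, hfu, huv, hfv⟩ := geometric_hahn_banach_compact_closed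
    ((convex_stdSimplex ℝ Θ).linear_image T) ((isCompact_stdSimplex ℝ Θ).image hTc)
    (convex_Ici _) isClosed_Ici hdisj
  have hf : ∀ x : K → ℝ, f x = ∑ k, x k * f (Pi.single k 1) := by
    intro x
    conv_lhs => rw [pi_eq_sum_univ' x]
    rw [map_sum]
    refine Finset.sum_congr rfl fun k _ => ?_
    rw [map_smul, smul_eq_mul]
  have hc : ∀ k, 0 ≤ f (Pi.single k 1) := by
    intro k
    by_contra! hneg
    have hb := hfv (fun _ => β) Set.self_mem_Ici
    set t := (v - f fun _ => β) / f (Pi.single k 1) with ht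
    have ht0 : 0 ≤ t := div_nonneg_of_nonpos (by linarith) hneg.le
    have hmem : (fun _ => β) + t • Pi.single k (1 : ℝ) ∈ Set.Ici (fun _ : K => β) := by
      intro i
      have : 0 ≤ t * (Pi.single k (1 : ℝ) : K → ℝ) i :=
        mul_nonneg ht0 (by by_cases hi : i = k <;> simp [hi])
      simpa using this
    have := hfv _ hmem
    rw [map_add, map_smul, smul_eq_mul, ht, div_mul_cancel₀ _ hneg.ne] at this
    linarith
  have hs : 0 < ∑ k, f (Pi.single k 1) := by
    refine (Finset.sum_nonneg fun k _ => hc k).lt_of_ne fun h0 => ?_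
    have hzero : ∀ x, f x = 0 := by
      intro x
      rw [hf]
      refine Finset.sum_eq_zero fun k hk => ?_
      rw [(Finset.sum_eq_zero_iff_of_nonneg fun k _ => hc k).1 h0.symm k hk, mul_zero]
    obtain ⟨k⟩ := ‹Nonempty K›
    obtain ⟨θ, -⟩ := h _ (single_mem_stdSimplex ℝ k)
    have h1 := hfu _ ⟨_, single_mem_stdSimplex ℝ θ, rfl⟩
    have h2 := hfv (fun _ => β) Set.self_mem_Ici
    rw [hzero] at h1 h2
    linarith
  obtain ⟨θ, hθ⟩ := h (fun k => f (Pi.single k 1) / ∑ i, f (Pi.single i 1))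
    ⟨fun k => div_nonneg (hc k) hs.le, by rw [← Finset.sum_div, div_self hs.ne']⟩
  have h1 := hfu _ ⟨_, single_mem_stdSimplex ℝ θ, rfl⟩
  have h2 := hfv (fun _ => β) Set.self_mem_Ici
  have h3 : T (Pi.single θ 1) = a θ := by
    ext k
    simp [hT, Pi.single_apply]
  rw [h3, hf] at h1
  rw [hf, ← Finset.mul_sum] at h2
  simp only [div_mul_eq_mul_div, ← Finset.sum_div, le_div_iff₀ hs] at hθ
  simp only [mul_comm (a θ _)] at h1
  linarith

/-- If every `f : Fin (m + 1) → K` contains, apart from one of its entries, a subfamily related to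
that entry, then for every probability weight on `K` some family is related to a fixed proportion
of `K`. -/
theorem exists_inv_card_le_sum {α K : Type*} [Fintype α] [Fintype K] {m : ℕ}
    (R : (α → K) → K → Prop) [∀ θ k, Decidable (R θ k)]
    (hR : ∀ f : Fin (m + 1) → K, ∃ j, ∃ g : α → Fin m, R (f ∘ j.succAbove ∘ g) (f j))
    (w : K → ℝ) (hw : w ∈ stdSimplex ℝ K) :
    ∃ θ, (Nat.card (Fin (m + 1) × (α → Fin m)) : ℝ)⁻¹ ≤ ∑ k, w k * if R θ k then 1 else 0 := by
  classical
  have : Nonempty K := by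
    by_contra h
    rw [not_nonempty_iff] at h
    simpa using hw.2
  let s : (α → K) → ℝ := fun θ => ∑ k, w k * if R θ k then 1 else 0
  obtain ⟨θ, hθ⟩ := Finite.exists_max s
  refine ⟨θ, ?_⟩
  have key : ∀ (j : Fin (m + 1)) (g : α → Fin m),
      ∑ f : Fin (m + 1) → K, (∏ i, w (f i)) * (if R (f ∘ j.succAbove ∘ g) (f j) then 1 else 0)
        ≤ s θ := by
    intro j g
    rw [← (Fin.insertNthEquiv (fun _ => K) j).sum_comp, Fintype.sum_prod_type_right]
    calc _ = ∑ f : Fin m → K, (∏ i, w (f i)) * s (f ∘ g) := by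
          refine Finset.sum_congr rfl fun f _ => ?_
          rw [Finset.mul_sum]
          refine Finset.sum_congr rfl fun k _ => ?_
          rw [Fin.prod_univ_succAbove _ j]
          have : Fin.insertNthEquiv (fun _ => K) j (k, f) ∘ j.succAbove ∘ g = f ∘ g := by
            ext
            simp
          rw [this]
          simp only [Fin.insertNthEquiv_apply, Fin.insertNth_apply_same,
            Fin.insertNth_apply_succAbove]
          ring
      _ ≤ ∑ f : Fin m → K, (∏ i, w (f i)) * s θ :=
          Finset.sum_le_sum fun f _ => mul_le_mul_of_nonneg_left (hθ _)
            (Finset.prod_nonneg fun i _ => hw.1 _)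
      _ = s θ := by rw [← Finset.sum_mul, ← Fintype.sum_pow, hw.2, one_pow, one_mul]
  have h1 : (1 : ℝ) ≤ Nat.card (Fin (m + 1) × (α → Fin m)) * s θ := by
    calc (1 : ℝ) = ∑ f : Fin (m + 1) → K, ∏ i, w (f i) := by
          rw [← Fintype.sum_pow, hw.2, one_pow]
      _ ≤ ∑ f : Fin (m + 1) → K, ∑ q : Fin (m + 1) × (α → Fin m),
            (∏ i, w (f i)) * (if R (f ∘ q.1.succAbove ∘ q.2) (f q.1) then 1 else 0) := by
          refine Finset.sum_le_sum fun f _ => ?_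
          obtain ⟨j, g, h⟩ := hR f
          have hprod : 0 ≤ ∏ i, w (f i) := Finset.prod_nonneg fun i _ => hw.1 _
          refine le_trans ?_ (Finset.single_le_sum (f := fun q : Fin (m + 1) × (α → Fin m) =>
            (∏ i, w (f i)) * (if R (f ∘ q.1.succAbove ∘ q.2) (f q.1) then 1 else 0))
            (fun q _ => mul_nonneg hprod (by split_ifs <;> norm_num)) (Finset.mem_univ (j, g)))
          simp [h]
      _ ≤ ∑ q : Fin (m + 1) × (α → Fin m), s θ := by
          rw [Finset.sum_comm]
          exact Finset.sum_le_sum fun q _ => key q.1 q.2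
      _ = _ := by simp
  have hN : (0 : ℝ) < Nat.card (Fin (m + 1) × (α → Fin m)) := by
    refine lt_of_le_of_ne (Nat.cast_nonneg _) fun h => ?_
    rw [← h] at h1
    norm_num at h1
  rwa [inv_le_iff_one_le_mul₀' hN]

theorem exists_injective_image_of_mul_lt {K : Type*} [DecidableEq K] {q p P : ℕ}
    (hP : q * (p - 1) < P) (G : Finset K → Prop) (hsing : ∀ k, G {k})
    (hG : ∀ S : Finset K, S.card = p → ∃ T ⊆ S, T.card = q + 1 ∧ G T) (f : Fin P → K) :
    ∃ e : Fin (q + 1) → Fin P, Function.Injective e ∧ G (Finset.univ.image (f ∘ e)) := by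
  by_cases hfib : ∃ y, q + 1 ≤ (Finset.univ.filter fun x => f x = y).card
  · obtain ⟨y, hy⟩ := hfib
    obtain ⟨s, hs, hcard⟩ := Finset.exists_subset_card_eq hy
    refine ⟨s.orderEmbOfFin hcard, (s.orderEmbOfFin hcard).injective, ?_⟩
    convert hsing y
    have : f ∘ s.orderEmbOfFin hcard = fun _ => y := by
      ext i
      exact (Finset.mem_filter.1 (hs (s.orderEmbOfFin_mem hcard i))).2
    rw [this]
    exact Finset.image_const ⟨0, Finset.mem_univ _⟩ y
  · push Not at hfib
    have hle := Finset.card_le_mul_card_image (f := f) Finset.univ q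
      fun a _ => Nat.lt_succ_iff.1 (hfib a)
    rw [Finset.card_univ, Fintype.card_fin] at hle
    have hp : p ≤ (Finset.univ.image f).card := by
      have := Nat.lt_of_mul_lt_mul_left (hP.trans_le hle)
      omega
    obtain ⟨S, hS, hScard⟩ := Finset.exists_subset_card_eq hp
    obtain ⟨T, hT, hTcard, hGT⟩ := hG S hScard
    have hpre : ∀ i : Fin (q + 1), ∃ x, f x = (T.equivFinOfCardEq hTcard).symm i := fun i => by
      simpa using hS (hT ((T.equivFinOfCardEq hTcard).symm i).2)
    choose e he using hpre
    refine ⟨e, fun i j hij => ?_, ?_⟩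
    · apply (T.equivFinOfCardEq hTcard).symm.injective
      rw [Subtype.ext_iff, ← he, ← he, hij]
    · convert hGT
      ext k
      simp only [Finset.mem_image, Finset.mem_univ, true_and, Function.comp_apply, he]
      exact ⟨fun ⟨i, hi⟩ => hi ▸ Subtype.prop _,
        fun hk => ⟨T.equivFinOfCardEq hTcard ⟨k, hk⟩, by simp⟩⟩

namespace IsEllipsoid

variable {d : ℕ} {E : Set (EuclideanSpace ℝ (Fin d))}

theorem convex (hE : IsEllipsoid E) : Convex ℝ E := by
  obtain ⟨L, rfl⟩ := hE
  exact (convex_closedBall _ _).affine_image L.toAffineMap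

theorem isCompact (hE : IsEllipsoid E) : IsCompact E := by
  obtain ⟨L, rfl⟩ := hE
  exact (isCompact_closedBall _ _).image L.continuous_of_finiteDimensional

theorem nonempty_interior (hE : IsEllipsoid E) : (interior E).Nonempty := by
  obtain ⟨L, rfl⟩ := hE
  change (interior ((AffineEquiv.toContinuousAffineEquiv L).toHomeomorph '' _)).Nonempty
  rw [← Homeomorph.image_interior]
  exact Set.Nonempty.image _ ⟨0, Metric.ball_subset_interior_closedBall (by simp)⟩

theorem image_add_smul (hE : IsEllipsoid E) (x : EuclideanSpace ℝ (Fin d)) {r : ℝ} (hr : r ≠ 0) :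
    IsEllipsoid ((fun e => x + r • e) '' E) := by
  obtain ⟨L, rfl⟩ := hE
  refine ⟨L.trans ((LinearEquiv.smulOfNeZero ℝ _ r hr).toAffineEquiv.trans
    (AffineEquiv.constVAdd ℝ _ x)), ?_⟩
  rw [Set.image_image]
  rfl

end IsEllipsoid

open scoped Pointwise in
theorem volume_image_add_smul {d : ℕ} (E : Set (EuclideanSpace ℝ (Fin d)))
    (x : EuclideanSpace ℝ (Fin d)) {r : ℝ} (hr : 0 ≤ r) :
    volume ((fun e => x + r • e) '' E) = ENNReal.ofReal (r ^ d) * volume E := by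
  have : (fun e => x + r • e) '' E = x +ᵥ (r • E) := by
    rw [← Set.image_smul, ← Set.image_vadd, Set.image_image]
    rfl
  rw [this, measure_vadd, Measure.addHaar_smul, finrank_euclideanSpace_fin,
    abs_of_nonneg (pow_nonneg hr d)]

/-- Convex sets can be shrunk to compact convex sets without destroying the existence of ellipsoids
of volume one in their intersections. -/
theorem exists_isCompact_convex_subset {d : ℕ} {K : Type*} [Finite K]
    (C : K → Set (EuclideanSpace ℝ (Fin d))) (hC : ∀ k, Convex ℝ (C k)) :
    ∃ A : K → Set (EuclideanSpace ℝ (Fin d)), (∀ k, Convex ℝ (A k)) ∧ (∀ k, IsCompact (A k)) ∧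
      (∀ k, A k ⊆ C k) ∧
      ∀ T : Finset K, (∃ E, IsEllipsoid E ∧ volume E = 1 ∧ E ⊆ ⋂ i ∈ T, C i) →
        ∃ E, IsEllipsoid E ∧ volume E = 1 ∧ E ⊆ ⋂ i ∈ T, A i := by
  classical
  have := Fintype.ofFinite K
  let Good : Finset K → Prop := fun T => ∃ E, IsEllipsoid E ∧ volume E = 1 ∧ E ⊆ ⋂ i ∈ T, C i
  have hex : ∀ T, ∃ E, Good T → IsEllipsoid E ∧ volume E = 1 ∧ E ⊆ ⋂ i ∈ T, C i := by
    intro T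
    by_cases h : Good T
    · obtain ⟨E, hE⟩ := h
      exact ⟨E, fun _ => hE⟩
    · exact ⟨∅, fun h' => absurd h' h⟩
  choose ell hell using hex
  refine ⟨fun k => convexHull ℝ (⋃ T ∈ Finset.univ.filter fun T => Good T ∧ k ∈ T, ell T),
    fun k => convex_convexHull ℝ _, fun k => isCompact_convexHull_biUnion _ _ ?_ ?_, fun k => ?_,
    fun T hT => ⟨ell T, (hell T hT).1, (hell T hT).2.1, Set.subset_iInter₂ fun k hk => ?_⟩⟩
  · exact fun T hT => (hell T (Finset.mem_filter.1 hT).2.1).1.convex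
  · exact fun T hT => (hell T (Finset.mem_filter.1 hT).2.1).1.isCompact
  · refine convexHull_min (Set.iUnion₂_subset fun T hT => ?_) (hC k)
    obtain ⟨-, hT, hk⟩ := Finset.mem_filter.1 hT
    exact (hell T hT).2.2.trans (Set.iInter₂_subset k hk)
  · refine Set.Subset.trans ?_ (subset_convexHull ℝ _)
    exact Set.subset_biUnion_of_mem (u := ell) (x := T)
      (Finset.mem_coe.2 (Finset.mem_filter.2 ⟨Finset.mem_univ _, hT, hk⟩))

/-- Given compact convex sets in `ℝ^d`, one can attach to each `3 * d`-tuple of them a small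
ellipsoid, such that whenever `3 * d + 1` of the sets contain a common ellipsoid of volume one, the
small ellipsoid of some `3 * d` among them lies in the remaining one. -/
theorem exists_ellipsoid_selection {d : ℕ} (hd : 1 ≤ d) {K : Type*}
    (A : K → Set (EuclideanSpace ℝ (Fin d))) (hconv : ∀ k, Convex ℝ (A k))
    (hcomp : ∀ k, IsCompact (A k))
    (hE : ∃ E : Set (EuclideanSpace ℝ (Fin d)), IsEllipsoid E ∧ volume E = 1)
    {ρ : ℝ} (h0 : 0 < ρ) (h1 : ρ * (d ^ 2 + 2 * d) ≤ 1) :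
    ∃ Φ : (Fin (2 * d) ⊕ Fin d → K) → Set (EuclideanSpace ℝ (Fin d)),
      (∀ θ, IsEllipsoid (Φ θ) ∧ volume (Φ θ) = ENNReal.ofReal (ρ ^ d)) ∧
      ∀ t : Fin (3 * d + 1) → K,
        (∃ E, IsEllipsoid E ∧ volume E = 1 ∧ E ⊆ ⋂ i, A (t i)) →
        ∃ j, ∃ g : Fin (2 * d) ⊕ Fin d → Fin (3 * d + 1),
          (∀ a, g a ≠ j) ∧ Φ (t ∘ g) ⊆ A (t j) := by
  have hex : ∀ σ : Fin (2 * d) → K, ∃ E : Set (EuclideanSpace ℝ (Fin d)),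
      (IsEllipsoid E ∧ volume E = 1) ∧
      ((∃ E, IsEllipsoid E ∧ volume E = 1 ∧ E ⊆ ⋂ i, A (σ i)) → E ⊆ ⋂ i, A (σ i)) := by
    intro σ
    by_cases h : ∃ E, IsEllipsoid E ∧ volume E = 1 ∧ E ⊆ ⋂ i, A (σ i)
    · obtain ⟨E, hE, hvol, hsub⟩ := h
      exact ⟨E, ⟨hE, hvol⟩, fun _ => hsub⟩
    · obtain ⟨E, hE⟩ := hE
      exact ⟨E, hE, fun h' => absurd h' h⟩
  choose ell hell hsub using hex
  let D : (Fin (2 * d) → K) → K → Set (EuclideanSpace ℝ (Fin d)) := fun σ k =>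
    ⋂ e ∈ ell σ, (fun x => x + ρ • e) ⁻¹' A k
  have hsel := fun σ => exists_selection_mem_of_iInter_nonempty (D σ)
    (fun k => convex_iInter₂ fun e _ => (hconv k).translate_preimage_left _)
    (fun k => isClosed_biInter fun e _ => (hcomp k).isClosed.preimage (by fun_prop))
  choose m hm using hsel
  refine ⟨fun θ => (fun e => m (θ ∘ Sum.inl) (θ ∘ Sum.inr) + ρ • e) '' ell (θ ∘ Sum.inl),
    fun θ => ⟨(hell _).1.image_add_smul _ h0.ne', ?_⟩, ?_⟩
  · rw [volume_image_add_smul _ _ h0.le, (hell _).2, mul_one]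
  rintro t ⟨E, hEll, hEvol, hEsub⟩
  obtain ⟨J, hJ, o, ho⟩ := exists_card_le_iInter_subset_homothety hd (fun i => A (t i))
    (fun i => hconv _) (fun i => hcomp _) (hEll.nonempty_interior.mono (interior_mono hEsub))
  obtain ⟨J', hJJ', hJ'⟩ := Finset.exists_superset_card_eq hJ
    (by rw [Fintype.card_fin]; omega)
  have hJc : J'ᶜ.card = d + 1 := by
    rw [Finset.card_compl, hJ', Fintype.card_fin]
    omega
  let a := J'.orderEmbOfFin hJ'
  let b := J'ᶜ.orderEmbOfFin hJc
  have hEσ := hsub (t ∘ a) ⟨E, hEll, hEvol, hEsub.trans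
    (Set.subset_iInter fun i => Set.iInter_subset _ _)⟩
  have hx : ((1 - ρ) • o) ∈ ⋂ j, D (t ∘ a) ((t ∘ b) j) := by
    refine Set.mem_iInter.2 fun j => Set.mem_iInter₂.2 fun e he => ?_
    have := Set.mem_iInter.1 (ho ρ h0.le h1 e (Set.mem_iInter₂.2 fun i hi => ?_)) (b j)
    · have heq : o + ρ • (e - o) = (1 - ρ) • o + ρ • e := by module
      rwa [heq] at this
    · obtain ⟨k, rfl⟩ : i ∈ Set.range a := by
        rw [Finset.range_orderEmbOfFin]
        exact hJJ' hi
      exact Set.mem_iInter.1 (hEσ he) k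
  obtain ⟨j, hj⟩ := hm (t ∘ a) (t ∘ b) ⟨_, hx⟩
  refine ⟨b j, Sum.elim a (b ∘ j.succAbove), ?_, ?_⟩
  · rintro (i | i) h
    · exact Finset.mem_compl.1 (J'ᶜ.orderEmbOfFin_mem hJc j) (h ▸ J'.orderEmbOfFin_mem hJ' i)
    · exact j.succAbove_ne i (b.injective h)
  · rintro _ ⟨e, he, rfl⟩
    exact Set.mem_iInter₂.1 hj e he

theorem finsum_mem_sum_ite_eq {Θ X : Type*} [Fintype Θ] [DecidableEq X] (Φ : Θ → X) (μ : Θ → ℝ)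
    (s : Set X) [DecidablePred (· ∈ s)] :
    ∑ᶠ x ∈ s, ∑ θ, (if Φ θ = x then μ θ else 0) = ∑ θ, if Φ θ ∈ s then μ θ else 0 := by
  have h : ∀ x, (∑ᶠ (_ : x ∈ s), ∑ θ, if Φ θ = x then μ θ else 0) =
      ∑ θ, if x = Φ θ then (if Φ θ ∈ s then μ θ else 0) else 0 := by
    intro x
    by_cases hx : x ∈ s
    · rw [finsum_eq_if, if_pos hx]
      refine Finset.sum_congr rfl fun θ _ => ?_
      by_cases h : Φ θ = x
      · simp [h, hx]
      · simp [h, Ne.symm h]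
    · rw [finsum_eq_if, if_neg hx]
      refine (Finset.sum_eq_zero fun θ _ => ?_).symm
      by_cases h : x = Φ θ
      · simp [← h, hx]
      · simp [h]
  simp only [h]
  rw [finsum_sum_comm]
  · refine Finset.sum_congr rfl fun θ _ => ?_
    rw [finsum_eq_single _ (Φ θ) fun x hx => if_neg hx, if_pos rfl]
  · refine fun θ _ => (Set.finite_singleton (Φ θ)).subset fun x hx => ?_
    by_contra hne
    exact hx (if_neg hne)

theorem quarter_pow_mul_rpow_mul_le_one {d : ℕ} (hd : 1 ≤ d) :
    (1 / 4 : ℝ) ^ d * (d : ℝ) ^ (1 - 5 * (d : ℝ) / 2) * ((d : ℝ) ^ 2 + 2 * d) ≤ 1 := by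
  have hd' : (1 : ℝ) ≤ d := by exact_mod_cast hd
  have hd0 : (0 : ℝ) < d := by linarith
  have h1 : (d : ℝ) ^ (1 - 5 * (d : ℝ) / 2) ≤ (d : ℝ)⁻¹ := by
    rw [← Real.rpow_neg_one]
    exact Real.rpow_le_rpow_of_exponent_le hd' (by linarith)
  have h2 := one_add_mul_le_pow (a := (3 : ℝ)) (by norm_num) d
  norm_num at h2
  calc (1 / 4 : ℝ) ^ d * (d : ℝ) ^ (1 - 5 * (d : ℝ) / 2) * ((d : ℝ) ^ 2 + 2 * d)
      ≤ (1 / 4 : ℝ) ^ d * (d : ℝ)⁻¹ * ((d : ℝ) ^ 2 + 2 * d) := by gcongr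
    _ = ((d : ℝ) + 2) / 4 ^ d := by
      rw [one_div, inv_pow]
      field_simp
    _ ≤ 1 := by
      rw [div_le_one (by positivity)]
      linarith

theorem quarter_pow_mul_rpow_pow (d : ℕ) :
    ((1 / 4 : ℝ) ^ d * (d : ℝ) ^ (1 - 5 * (d : ℝ) / 2)) ^ d =
      (1 / 4 : ℝ) ^ (d ^ 2) * (d : ℝ) ^ (-(5 * (d : ℝ) ^ 2 / 2) + (d : ℝ)) := by
  rw [mul_pow, ← pow_mul, ← sq, ← Real.rpow_mul_natCast d.cast_nonneg]
  congr 2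
  ring

/-- Boundedness of the quantitative fractional v-transversal number. -/
theorem bounded_fractional_v_transversal :
    ∃ c : ℝ, 0 < c ∧
      ∀ d : ℕ, 1 ≤ d →
        ∀ p : ℕ, 3 * d + 1 ≤ p →
          ∃ h : ℝ, 0 < h ∧
            ∀ n : ℕ, ∀ C : Fin n → Set (EuclideanSpace ℝ (Fin d)),
              (∀ i, Convex ℝ (C i)) →
              (∀ i, ∃ E, IsEllipsoid E ∧ volume E = 1 ∧ E ⊆ C i) →
              (∀ S : Finset (Fin n), S.card = p →
                ∃ T ⊆ S, T.card = 3 * d + 1 ∧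
                  ∃ E, IsEllipsoid E ∧ volume E = 1 ∧ E ⊆ ⋂ i ∈ T, C i) →
              ∃ φ : Set (EuclideanSpace ℝ (Fin d)) → ℝ,
                (∀ E, 0 ≤ φ E) ∧
                (Function.support φ).Finite ∧
                (∀ E, φ E ≠ 0 → IsEllipsoid E ∧
                  volume E = ENNReal.ofReal
                    (c ^ (d ^ 2) *
                      (d : ℝ) ^ (-(5 * (d : ℝ) ^ 2 / 2) + (d : ℝ)))) ∧
                (∀ i, 1 ≤ ∑ᶠ E ∈ {E : Set (EuclideanSpace ℝ (Fin d)) |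
                    IsEllipsoid E ∧
                    volume E = ENNReal.ofReal
                      (c ^ (d ^ 2) *
                        (d : ℝ) ^ (-(5 * (d : ℝ) ^ 2 / 2) + (d : ℝ))) ∧
                    E ⊆ C i}, φ E) ∧
                (∑ᶠ E, φ E) < h := by
  classical
  refine ⟨1 / 4, by norm_num, fun d hd p hp => ?_⟩
  set N := (Nat.card (Fin (3 * d * (p - 1) + 1) ×
    (Fin (2 * d) ⊕ Fin d → Fin (3 * d * (p - 1)))) : ℝ)
  have hm : 0 < 3 * d * (p - 1) := Nat.mul_pos (by omega) (by omega)
  have : Nonempty (Fin (3 * d * (p - 1))) := ⟨⟨0, hm⟩⟩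
  have hN0 : 0 < N := Nat.cast_pos.2 Nat.card_pos
  refine ⟨N + 1, by linarith, fun n C hC hCE hCp => ?_⟩
  rcases isEmpty_or_nonempty (Fin n) with hn | hn
  · refine ⟨0, fun _ => le_rfl, by simp, fun E hE => absurd rfl hE, fun i => isEmptyElim i, ?_⟩
    simp only [Pi.zero_apply, finsum_zero]
    linarith
  set ρ : ℝ := (1 / 4 : ℝ) ^ d * (d : ℝ) ^ (1 - 5 * (d : ℝ) / 2) with hρ
  have hρ0 : 0 < ρ := by
    have : (0 : ℝ) < d := by exact_mod_cast hd
    positivity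
  rw [← quarter_pow_mul_rpow_pow d, ← hρ]
  obtain ⟨A, hAconv, hAcomp, hAC, hAE⟩ := exists_isCompact_convex_subset C hC
  obtain ⟨Φ, hΦ, hΦA⟩ := exists_ellipsoid_selection hd A hAconv hAcomp
    (hn.elim fun i => let ⟨E, hE, hvol, _⟩ := hCE i; ⟨E, hE, hvol⟩) hρ0
    (quarter_pow_mul_rpow_mul_le_one hd)
  have hR : ∀ f : Fin (3 * d * (p - 1) + 1) → Fin n, ∃ j,
      ∃ g : Fin (2 * d) ⊕ Fin d → Fin (3 * d * (p - 1)),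
        Φ (f ∘ j.succAbove ∘ g) ⊆ C (f j) := by
    intro f
    obtain ⟨e, he, E, hE, hvol, hsub⟩ := exists_injective_image_of_mul_lt (Nat.lt_succ_self _)
      (fun T => ∃ E, IsEllipsoid E ∧ volume E = 1 ∧ E ⊆ ⋂ i ∈ T, A i)
      (fun k => hAE _ (by simpa using hCE k))
      (fun S hS => by
        obtain ⟨T, hTS, hT, hE⟩ := hCp S hS
        exact ⟨T, hTS, hT, hAE T hE⟩) f
    obtain ⟨j, g, hgj, hsubA⟩ := hΦA (f ∘ e) ⟨E, hE, hvol, hsub.trans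
      (Set.subset_iInter fun i => Set.iInter₂_subset _
        (Finset.mem_image_of_mem _ (Finset.mem_univ i)))⟩
    have hex : ∀ a, ∃ b, (e j).succAbove b = e (g a) := fun a =>
      Fin.exists_succAbove_eq fun h => hgj a (he h)
    choose g' hg' using hex
    refine ⟨e j, g', ?_⟩
    have : f ∘ (e j).succAbove ∘ g' = (f ∘ e) ∘ g := by
      ext a
      simp [hg']
    rw [this]
    exact hsubA.trans (hAC _)
  obtain ⟨μ, hμ, hμN⟩ := exists_mem_stdSimplex_forall_le_sum
    (fun θ k => if Φ θ ⊆ C k then (1 : ℝ) else 0) N⁻¹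
    fun w hw => exists_inv_card_le_sum (fun θ k => Φ θ ⊆ C k) hR w hw
  have hnonneg : ∀ E, 0 ≤ ∑ θ, if Φ θ = E then N * μ θ else 0 := fun E =>
    Finset.sum_nonneg fun θ _ => by
      split_ifs
      · exact mul_nonneg hN0.le (hμ.1 θ)
      · exact le_rfl
  have hsupp : ∀ E, (∑ θ, if Φ θ = E then N * μ θ else 0) ≠ 0 → E ∈ Set.range Φ := by
    intro E hE
    obtain ⟨θ, -, hθ⟩ := Finset.exists_ne_zero_of_sum_ne_zero hE
    exact ⟨θ, by_contra fun h => hθ (if_neg h)⟩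
  refine ⟨fun E => ∑ θ, if Φ θ = E then N * μ θ else 0, hnonneg,
    (Set.finite_range Φ).subset hsupp, ?_, fun i => ?_, ?_⟩
  · intro E hE
    obtain ⟨θ, rfl⟩ := hsupp E hE
    exact hΦ θ
  · rw [finsum_mem_sum_ite_eq]
    have h := (inv_le_iff_one_le_mul₀' hN0).1 (hμN i)
    rw [Finset.mul_sum] at h
    refine h.trans (Finset.sum_le_sum fun θ _ => ?_)
    by_cases hθ : Φ θ ⊆ C i
    · simp [hθ, hΦ θ]
    · simp [hθ]
  · have h := finsum_mem_sum_ite_eq Φ (fun θ => N * μ θ) Set.univ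
    simp only [Set.mem_univ, finsum_true, if_true, ← Finset.mul_sum, hμ.2] at h
    rw [h]
    linarith
end
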